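/- arXiv:2003.03084 — 3 statements merged into one kernel-verified Lean document; each statement's English description precedes it below -/
import Mathlib

section
/- Let G1 be a traceable graph of order at least 3 and G2 a connected 3-regular graph with no cut-edge. Then G1 □ G2 is Hamiltonian. -/
open SimpleGraph

/-- A spanning subgraph each of whose components is a path of order at least 2. -/
def SimpleGraph.Subgraph.IsPathFactor {V : Type*} {G : SimpleGraph V} (F : G.Subgraph) : Prop :=
  F.verts = Set.univ ∧
    ∀ c : F.coe.ConnectedComponent,
      ∃ k : ℕ, 2 ≤ k ∧ Nonempty (F.coe.induce c.supp ≃g pathGraph k)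

/-- `G` has a path factor. -/
def SimpleGraph.HasPathFactor {V : Type*} (G : SimpleGraph V) : Prop :=
  ∃ F : G.Subgraph, F.IsPathFactor

/-- A spanning subgraph each of whose components is isomorphic to `P₂` or `P₃`. -/
def SimpleGraph.Subgraph.IsP2P3Factor {V : Type*} {G : SimpleGraph V} (F : G.Subgraph) : Prop :=
  F.verts = Set.univ ∧
    ∀ c : F.coe.ConnectedComponent,
      ∃ k : ℕ, (k = 2 ∨ k = 3) ∧ Nonempty (F.coe.induce c.supp ≃g pathGraph k)

/-- The number of isolated vertices of `G − S`. -/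
noncomputable def SimpleGraph.numIsolatedOutside {V : Type*} (G : SimpleGraph V) (S : Set V) : ℕ :=
  Nat.card {v : V | v ∉ S ∧ ∀ w, G.Adj v w → w ∈ S}

/-- The number of connected components of `G − S`. -/
noncomputable def SimpleGraph.numComponentsOutside {V : Type*} (G : SimpleGraph V) (S : Set V) : ℕ :=
  Nat.card (G.induce Sᶜ).ConnectedComponent

/-- `G` is 1-tough: any cut set `S` satisfies `|S| ≥ c(G − S)`. -/
def SimpleGraph.IsOneTough {V : Type*} [Fintype V] (G : SimpleGraph V) : Prop :=
  ∀ S : Finset V, 2 ≤ G.numComponentsOutside ↑S → G.numComponentsOutside ↑S ≤ S.card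

/-- `G` is traceable: it has a Hamiltonian path. -/
def SimpleGraph.Traceable {V : Type*} [DecidableEq V] (G : SimpleGraph V) : Prop :=
  ∃ (a b : V) (p : G.Walk a b), p.IsHamiltonian


lemma aux_boundary {V : Type*} [Fintype V] [DecidableEq V] (G : SimpleGraph V) [DecidableRel G.Adj]
    (hreg : G.IsRegularOfDegree 3) (hbridge : ∀ e ∈ G.edgeSet, ¬ G.IsBridge e)
    (C : Finset V) (hC : Odd C.card) :
    3 ≤ (Finset.univ.filter (fun d : V × V => d.1 ∈ C ∧ d.2 ∉ C ∧ G.Adj d.1 d.2)).card := by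
  have h1 : (Finset.univ.filter (fun d : V × V => d.1 ∈ C ∧ G.Adj d.1 d.2)).card = 3 * C.card := by
    have : (Finset.univ.filter (fun d : V × V => d.1 ∈ C ∧ G.Adj d.1 d.2)) =
        (C.sigma (fun v => G.neighborFinset v)).map
          ⟨fun x => (x.1, x.2), by rintro ⟨a, b⟩ ⟨c, d⟩ h; simp at h; simp [h]⟩ := by
      ext ⟨a, b⟩
      simp only [Finset.mem_filter, Finset.mem_map, Finset.mem_sigma, mem_neighborFinset]
      constructor
      · rintro ⟨-, h1, h2⟩
        exact ⟨⟨a, b⟩, ⟨h1, h2⟩, rfl⟩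
      · rintro ⟨⟨a', b'⟩, ⟨h1, h2⟩, h⟩
        cases h
        exact ⟨Finset.mem_univ _, h1, h2⟩
    rw [this, Finset.card_map, Finset.card_sigma]
    simp only [card_neighborFinset_eq_degree, hreg.degree_eq]
    simp [mul_comm]
  have h2 : Even (Finset.univ.filter (fun d : V × V => d.1 ∈ C ∧ d.2 ∈ C ∧ G.Adj d.1 d.2)).card := by
    have : ∑ d ∈ (Finset.univ.filter (fun d : V × V => d.1 ∈ C ∧ d.2 ∈ C ∧ G.Adj d.1 d.2)),
        (1 : ZMod 2) = 0 := by
      refine Finset.sum_involution (fun d _ => (d.2, d.1)) ?_ ?_ ?_ ?_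
      · intros; decide
      · rintro ⟨a, b⟩ h _
        simp at h
        intro h'
        simp at h'
        exact h.2.2.ne h'.2
      · rintro ⟨a, b⟩ h
        simp at h ⊢
        exact ⟨h.2.1, h.1, h.2.2.symm⟩
      · rintro ⟨a, b⟩ h; rfl
    rw [Finset.sum_const, nsmul_eq_mul, mul_one] at this
    exact (ZMod.natCast_eq_zero_iff_even).1 this
  have h3 := Finset.card_filter_add_card_filter_not
    (s := Finset.univ.filter (fun d : V × V => d.1 ∈ C ∧ G.Adj d.1 d.2)) (fun d => d.2 ∈ C)
  rw [Finset.filter_filter, Finset.filter_filter] at h3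
  have e1 : (Finset.univ.filter (fun d : V × V => (d.1 ∈ C ∧ G.Adj d.1 d.2) ∧ d.2 ∈ C)) =
     (Finset.univ.filter (fun d : V × V => d.1 ∈ C ∧ d.2 ∈ C ∧ G.Adj d.1 d.2)) := by
    ext; simp; tauto
  have e2 : (Finset.univ.filter (fun d : V × V => (d.1 ∈ C ∧ G.Adj d.1 d.2) ∧ d.2 ∉ C)) =
     (Finset.univ.filter (fun d : V × V => d.1 ∈ C ∧ d.2 ∉ C ∧ G.Adj d.1 d.2)) := by
    ext; simp; tauto
  rw [e1, e2, h1] at h3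
  have h4 : (Finset.univ.filter (fun d : V × V => d.1 ∈ C ∧ d.2 ∉ C ∧ G.Adj d.1 d.2)).card ≠ 1 := by
    intro h
    obtain ⟨⟨x, y⟩, hxy⟩ := Finset.card_eq_one.1 h
    have hm : ∀ a b, (a ∈ C ∧ b ∉ C ∧ G.Adj a b) ↔ (a = x ∧ b = y) := by
      intro a b
      have := congrArg (fun s => (a, b) ∈ s) hxy
      simpa using this
    obtain ⟨hx, hy, hadj⟩ := (hm x y).2 ⟨rfl, rfl⟩
    apply hbridge s(x, y) hadj
    rw [isBridge_iff]
    rintro ⟨p⟩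
    obtain ⟨d, -, hd1, hd2⟩ := p.exists_boundary_dart (C : Set V) (by simpa using hx) (by simpa using hy)
    have hd := d.adj
    rw [deleteEdges_adj] at hd
    have := (hm d.fst d.snd).1 ⟨by simpa using hd1, by simpa using hd2, hd.1⟩
    apply hd.2
    simp [this.1, this.2]
  rw [Nat.odd_iff] at hC
  rw [Nat.even_iff] at h2
  omega

lemma aux_petersen {V : Type*} [Fintype V] [DecidableEq V] (G : SimpleGraph V) [DecidableRel G.Adj]
    (hreg : G.IsRegularOfDegree 3) (hbridge : ∀ e ∈ G.edgeSet, ¬ G.IsBridge e) :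
    ∃ M : G.Subgraph, M.IsPerfectMatching := by
  classical
  rw [tutte]
  intro S hS
  unfold IsTutteViolator at hS
  set H := ((⊤ : G.Subgraph).deleteVerts S).coe with hH
  have : Fintype H.ConnectedComponent := Fintype.ofFinite _
  set O := H.oddComponents.toFinset with hO
  have hS' : S.toFinset.card < O.card := by
    rw [hO, ← Set.ncard_eq_toFinset_card', ← Set.ncard_eq_toFinset_card']
    exact hS
  let B : H.ConnectedComponent → Finset V := fun c => (Subtype.val '' c.supp).toFinset
  have hB : ∀ c v, v ∈ B c ↔ ∃ h : v ∈ ((⊤ : G.Subgraph).deleteVerts S).verts,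
      H.connectedComponentMk ⟨v, h⟩ = c := by
    intro c v
    simp [B, ConnectedComponent.mem_supp_iff]
  let D : H.ConnectedComponent → Finset (V × V) := fun c =>
    (Finset.univ.filter (fun d : V × V => d.1 ∈ B c ∧ d.2 ∉ B c ∧ G.Adj d.1 d.2))
  have hD : ∀ c ∈ O, 3 ≤ (D c).card := by
    intro c hc
    apply aux_boundary G hreg hbridge
    have hc' : Odd c.supp.ncard := by simpa [hO, oddComponents] using hc
    rw [← Set.ncard_image_of_injective c.supp Subtype.val_injective] at hc'
    rwa [Set.ncard_eq_toFinset_card'] at hc'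
  have hdisj : (O : Set H.ConnectedComponent).PairwiseDisjoint D := by
    intro c _ c' _ hne
    rw [Function.onFun, Finset.disjoint_left]
    rintro ⟨a, b⟩ h h'
    simp only [D, Finset.mem_filter, hB] at h h'
    obtain ⟨-, ⟨h1, h2⟩, -⟩ := h
    obtain ⟨-, ⟨h1', h2'⟩, -⟩ := h'
    exact hne (h2.symm.trans h2')
  have h1 : 3 * O.card ≤ (O.biUnion D).card := by
    rw [Finset.card_biUnion hdisj, mul_comm]
    simpa using Finset.card_nsmul_le_sum O (fun c => (D c).card) 3 hD
  have h2 : (O.biUnion D).card ≤ 3 * S.toFinset.card := by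
    have hc : (S.toFinset.sigma (fun v => G.neighborFinset v)).card = 3 * S.toFinset.card := by
      rw [Finset.card_sigma]
      simp only [card_neighborFinset_eq_degree, hreg.degree_eq]
      simp [mul_comm]
    rw [← hc]
    apply Finset.card_le_card_of_injOn (fun d => ⟨d.2, d.1⟩)
    · rintro ⟨a, b⟩ h
      simp only [Finset.coe_biUnion, Set.mem_iUnion, D, Finset.mem_coe, Finset.mem_filter] at h
      obtain ⟨c, -, -, h1, h2, h3⟩ := h
      simp only [Finset.mem_coe, Finset.mem_sigma, mem_neighborFinset, Set.mem_toFinset]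
      refine ⟨?_, h3.symm⟩
      by_contra hb
      obtain ⟨ha, hac⟩ := (hB _ _).1 h1
      apply h2
      have hb' : b ∈ ((⊤ : G.Subgraph).deleteVerts S).verts := by simpa using hb
      refine (hB _ _).2 ⟨hb', ?_⟩
      rw [← hac]
      apply ConnectedComponent.sound
      apply Adj.reachable
      rw [hH, Subgraph.coe_adj, Subgraph.deleteVerts_adj]
      simp at ha
      simp [ha, hb, h3.symm]
    · rintro ⟨a, b⟩ _ ⟨c, d⟩ _ h
      simp at h
      simp [h]
  omega

lemma aux_matching_acyclic {V : Type*} (G : SimpleGraph V) (M : G.Subgraph)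
    (hM : M.IsPerfectMatching) : M.spanningCoe.IsAcyclic := by
  intro v p hp
  have h1 := p.adj_snd hp.not_nil
  have h2 := (p.adj_penultimate hp.not_nil).symm
  rw [Subgraph.spanningCoe_adj] at h1 h2
  exact hp.snd_ne_penultimate ((Subgraph.isPerfectMatching_iff.1 hM v).unique h1 h2)

lemma aux_ham {X : Type*} [Fintype X] [DecidableEq X] (G : SimpleGraph X) (σ : Equiv.Perm X)
    (hadj : ∀ x, G.Adj x (σ x)) (hcyc : ∀ x y, σ.SameCycle x y) (hcard : 3 ≤ Fintype.card X) :
    G.IsHamiltonian := by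
  intro _
  obtain ⟨n, hn⟩ : ∃ n, Fintype.card X = n + 3 := ⟨_, (Nat.sub_add_cancel hcard).symm⟩
  obtain ⟨x⟩ : Nonempty X := Fintype.card_pos_iff.1 (by omega)
  have hs : σ.support = Finset.univ := by
    ext y; simpa using (hadj y).ne'
  have hC : σ.IsCycle := ⟨x, (hadj x).ne', fun y _ => hcyc x y⟩
  have ho : orderOf σ = n + 3 := by rw [hC.orderOf, hs, Finset.card_univ, hn]
  have hstep : ∀ i j : Fin (n+3), j - i = 1 → (σ ^ (j : ℕ)) x = σ ((σ ^ (i : ℕ)) x) := by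
    intro i j h
    have hj : j = i + 1 := by rw [← h]; abel
    have : ((j : ℕ)) = (i + 1) % (n + 3) := by rw [hj, Fin.val_add]; simp
    rw [this, ← Equiv.Perm.mul_apply, ← pow_succ', ← pow_mod_orderOf σ ((i : ℕ) + 1), ho]
  let f : cycleGraph (n+3) →g G :=
    { toFun := fun i => (σ ^ (i : ℕ)) x
      map_rel' := by
        intro i j h
        rw [cycleGraph_adj] at h
        rcases h with h | h
        · rw [hstep _ _ h]; exact (hadj _).symm
        · rw [hstep _ _ h]; exact hadj _ }
  have hf : Function.Bijective f := by
    rw [Fintype.bijective_iff_surjective_and_card]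
    refine ⟨fun y => ?_, by simp [hn]⟩
    obtain ⟨i, hi, h⟩ := (hcyc x y).exists_pow_eq'
    have : i < n + 3 := by
      exact ho ▸ hi
    exact ⟨⟨i, this⟩, h⟩
  have hH : (cycleGraph.cycle n).IsHamiltonianCycle := by
    rw [Walk.isHamiltonianCycle_iff_isCycle_and_length_eq]
    exact ⟨cycleGraph.isCycle_cycle, by simp⟩
  exact ⟨_, _, hH.map (f := f) hf⟩

lemma aux_merge {X : Type*} [Finite X] [DecidableEq X] (σ : Equiv.Perm X) (a b : X)
    (hab : ¬ σ.SameCycle a b) (y : X) (hy : σ.SameCycle b y) :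
    (σ * Equiv.swap a b).SameCycle a y := by
  have hne : a ≠ b := fun h => hab (h ▸ Equiv.Perm.SameCycle.refl _ _)
  have key : ∀ j : ℕ, (σ * Equiv.swap a b).SameCycle a ((σ ^ (j+1)) b) := by
    intro j
    induction j with
    | zero =>
      refine ⟨1, ?_⟩
      simp
    | succ j ih =>
      have hya : (σ ^ (j+1)) b ≠ a := fun h => hab (Equiv.Perm.SameCycle.symm ⟨((j + 1 : ℕ) : ℤ), by rw [zpow_natCast]; exact h⟩)
      rw [pow_succ', Equiv.Perm.mul_apply]
      by_cases hyb : (σ ^ (j+1)) b = b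
      · rw [hyb]
        refine ⟨1, ?_⟩
        simp
      · have : σ ((σ ^ (j+1)) b) = (σ * Equiv.swap a b) ((σ ^ (j+1)) b) := by
          rw [Equiv.Perm.mul_apply, Equiv.swap_apply_of_ne_of_ne hya hyb]
        rw [this]
        exact Equiv.Perm.sameCycle_apply_right.2 ih
  obtain ⟨i, h0, -, h⟩ := Equiv.Perm.SameCycle.exists_pow_eq'' hy
  obtain ⟨j, rfl⟩ : ∃ j, i = j + 1 := ⟨i - 1, by omega⟩
  exact h ▸ key j

section
variable {V : Type*} {k : ℕ}

def auxStep (c : V → Bool) (m : V → V) (x : Fin (k+3) × V) : Fin (k+3) × V :=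
  if c x.2 then (if h : x.1.val + 1 < k + 3 then (⟨x.1.val + 1, h⟩, x.2) else (x.1, m x.2))
  else (if x.1.val = 0 then (x.1, m x.2) else (⟨x.1.val - 1, by omega⟩, x.2))

def auxSrc (c : V → Bool) (i : Fin (k+2)) (v : V) : Fin (k+3) × V :=
  if c v then (i.castSucc, v) else (i.succ, v)

def auxTgt (c : V → Bool) (i : Fin (k+2)) (v : V) : Fin (k+3) × V :=
  if c v then (i.succ, v) else (i.castSucc, v)

lemma auxStep_inv (c : V → Bool) (m : V → V) (hm : ∀ v, m (m v) = v) (hc : ∀ v, c (m v) = !c v)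
    (x : Fin (k+3) × V) : auxStep (fun v => !c v) m (auxStep c m x) = x := by
  obtain ⟨⟨i, hi⟩, v⟩ := x
  unfold auxStep
  rcases hcv : c v
  · by_cases h : i = 0
    · simp [hcv, h, hc, hm]
    · have h1 : i - 1 + 1 = i := by omega
      simp [hcv, h, h1, hi]
  · by_cases h : i + 1 < k + 3 <;> simp [hcv, h, hc, hm]

def auxPerm (c : V → Bool) (m : V → V) (hm : ∀ v, m (m v) = v) (hc : ∀ v, c (m v) = !c v) :
    Equiv.Perm (Fin (k+3) × V) where
  toFun := auxStep c m
  invFun := auxStep (fun v => !c v) m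
  left_inv := auxStep_inv c m hm hc
  right_inv := by
    intro x
    have := auxStep_inv (k := k) (fun v => !c v) m hm (by simp [hc]) x
    simpa using this

lemma auxStep_src (c : V → Bool) (m : V → V) (i : Fin (k+2)) (v : V) :
    auxStep c m (auxSrc c i v) = auxTgt c i v := by
  unfold auxStep auxSrc auxTgt
  rcases hcv : c v
  · simp only [hcv, Bool.false_eq_true, if_false, Fin.val_succ, Nat.succ_ne_zero]
    rfl
  · have := i.isLt
    simp only [hcv, if_true, Fin.val_castSucc]
    rw [dif_pos (by omega)]
    rfl

lemma auxSrc_snd (c : V → Bool) (i : Fin (k+2)) (v : V) : (auxSrc c i v).2 = v := by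
  unfold auxSrc; split_ifs <;> rfl

lemma auxTgt_snd (c : V → Bool) (i : Fin (k+2)) (v : V) : (auxTgt c i v).2 = v := by
  unfold auxTgt; split_ifs <;> rfl

lemma auxSrc_fst (c : V → Bool) (i : Fin (k+2)) (v w : V) (h : c v ≠ c w) :
    (auxSrc c i v).1 = (auxTgt c i w).1 := by
  unfold auxSrc auxTgt
  rcases hv : c v <;> rcases hw : c w <;> simp_all

lemma auxSrc_ne (c : V → Bool) (v : V) : auxSrc (k := k) c 0 v ≠ auxSrc c 1 v := by
  unfold auxSrc
  have h1 : (1 : Fin (k+2)).val = 1 := rfl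
  have h0 : (0 : Fin (k+2)).val = 0 := rfl
  rcases hv : c v
  · intro h
    have := congrArg (fun x => x.1.val) h
    simp only [Bool.false_eq_true, if_false, Fin.val_succ, h1, h0] at this
    omega
  · intro h
    have := congrArg (fun x => x.1.val) h
    simp only [if_true, Fin.val_castSucc, h1, h0] at this
    omega

lemma auxStep_adj (G : SimpleGraph V) (c : V → Bool) (m : V → V) (hG : ∀ v, G.Adj v (m v))
    (x : Fin (k+3) × V) : (pathGraph (k+3) □ G).Adj x (auxStep c m x) := by
  obtain ⟨⟨i, hi⟩, v⟩ := x
  unfold auxStep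
  rcases hcv : c v
  · by_cases h : i = 0 <;> simp [hcv, h, boxProd_adj, pathGraph_adj, hG]
    omega
  · by_cases h : i + 1 < k + 3 <;> simp [hcv, h, boxProd_adj, pathGraph_adj, hG]

lemma auxStep_snd (c : V → Bool) (m : V → V) (x : Fin (k+3) × V) :
    (auxStep c m x).2 = x.2 ∨ (auxStep c m x).2 = m x.2 := by
  unfold auxStep
  split_ifs <;> simp

lemma auxLadder (c : V → Bool) (m : V → V) (hm : ∀ v, m (m v) = v) (hc : ∀ v, c (m v) = !c v)
    (σ : Equiv.Perm (Fin (k+3) × V)) (w : V)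
    (hσ : ∀ x, x.2 = w ∨ x.2 = m w → σ x = auxStep c m x)
    (x y : Fin (k+3) × V) (hx : x.2 = w ∨ x.2 = m w) (hy : y.2 = w ∨ y.2 = m w) :
    σ.SameCycle x y := by
  have col : ∀ v, (v = w ∨ v = m w) → ∀ (i : ℕ) (hi : i < k + 3),
      σ.SameCycle ((0 : Fin (k+3)), v) (⟨i, hi⟩, v) := by
    intro v hv i
    induction i with
    | zero => intro hi; exact Equiv.Perm.SameCycle.refl _ _
    | succ i ih =>
      intro hi
      refine (ih (by omega)).trans ?_
      rcases hcv : c v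
      · refine Equiv.Perm.SameCycle.symm ⟨1, ?_⟩
        rw [zpow_one, hσ _ hv]
        simp [auxStep, hcv]
      · refine ⟨1, ?_⟩
        rw [zpow_one, hσ _ hv]
        simp [auxStep, hcv, hi]
  have cross : σ.SameCycle ((0 : Fin (k+3)), w) ((0 : Fin (k+3)), m w) := by
    rcases hcv : c w
    · refine ⟨1, ?_⟩
      rw [zpow_one, hσ _ (Or.inl rfl)]
      simp [auxStep, hcv]
    · refine Equiv.Perm.SameCycle.symm ⟨1, ?_⟩
      rw [zpow_one, hσ _ (Or.inr rfl)]
      simp [auxStep, hcv, hc, hm]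
  have all : ∀ z : Fin (k+3) × V, z.2 = w ∨ z.2 = m w → σ.SameCycle ((0 : Fin (k+3)), w) z := by
    rintro ⟨⟨i, hi⟩, v⟩ hv
    rcases hv with h | h
    · simp at h; subst h; exact col _ (Or.inl rfl) i hi
    · simp at h; subst h; exact cross.trans (col _ (Or.inr rfl) i hi)
  exact (all x hx).symm.trans (all y hy)

structure AuxGood (G : SimpleGraph V) (c : V → Bool) (m : V → V)
    (σ : Equiv.Perm (Fin (k+3) × V)) (A : Set V) : Prop where
  adj : ∀ x, (pathGraph (k+3) □ G).Adj x (σ x)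
  clo : ∀ v ∈ A, m v ∈ A
  cyc : ∀ x y : Fin (k+3) × V, x.2 ∈ A → y.2 ∈ A → σ.SameCycle x y
  out : ∀ x : Fin (k+3) × V, x.2 ∉ A → σ x = auxStep c m x
  free : ∀ v ∈ A, (σ (auxSrc c 0 v) = auxTgt c 0 v ∧ σ (auxSrc c 1 v) = auxTgt c 1 v) ∨
    ((σ (auxSrc c 0 v) = auxTgt c 0 v ∨ σ (auxSrc c 1 v) = auxTgt c 1 v) ∧
      ∃ z ∈ A, G.Adj v z ∧ z ≠ m v) ∨ ∀ z, G.Adj v z → z ∈ A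

lemma auxGood_base (G : SimpleGraph V) (c : V → Bool) (m : V → V)
    (hm : ∀ v, m (m v) = v) (hc : ∀ v, c (m v) = !c v) (hG : ∀ v, G.Adj v (m v)) (w : V) :
    AuxGood (k := k) G c m (auxPerm c m hm hc) {w, m w} where
  adj := auxStep_adj G c m hG
  clo := by rintro v (rfl | rfl) <;> simp [hm]
  cyc := fun x y hx hy => auxLadder c m hm hc _ w (fun _ _ => rfl) x y hx hy
  out := fun _ _ => rfl
  free := fun v _ => Or.inl ⟨auxStep_src c m 0 v, auxStep_src c m 1 v⟩

lemma auxGood_step [Fintype V] [DecidableEq V] (G : SimpleGraph V) [DecidableRel G.Adj]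
    (hreg : G.IsRegularOfDegree 3) (c : V → Bool) (m : V → V)
    (hm : ∀ v, m (m v) = v) (hc : ∀ v, c (m v) = !c v) (hG : ∀ v, G.Adj v (m v))
    (σ : Equiv.Perm (Fin (k+3) × V)) (A : Set V) (h : AuxGood G c m σ A)
    (u w : V) (hu : u ∈ A) (hw : w ∉ A) (huw : G.Adj u w) (hcuw : c u ≠ c w) :
    ∃ σ', AuxGood (k := k) G c m σ' (insert w (insert (m w) A)) := by
  have hmw : m w ∉ A := fun h' => hw (by simpa [hm] using h.clo _ h')
  obtain ⟨i, hi01, hi⟩ : ∃ i : Fin (k+2), (i = 0 ∨ i = 1) ∧ σ (auxSrc c i u) = auxTgt c i u := by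
    rcases h.free u hu with h' | h' | h'
    · exact ⟨0, Or.inl rfl, h'.1⟩
    · rcases h'.1 with h'' | h''
      · exact ⟨0, Or.inl rfl, h''⟩
      · exact ⟨1, Or.inr rfl, h''⟩
    · exact absurd (h' w huw) hw
  have huw' : u ≠ w := huw.ne
  have hmuw : m w ≠ u := fun e => hmw (e ▸ hu)
  have hmww : m w ≠ w := (hG w).ne'
  have hwt : σ (auxSrc c i w) = auxTgt c i w := by
    rw [h.out _ (by rw [auxSrc_snd]; exact hw), auxStep_src]
  set a := auxSrc c i u with ha
  set b := auxSrc c i w with hb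
  have ha2 : a.2 = u := auxSrc_snd _ _ _
  have hb2 : b.2 = w := auxSrc_snd _ _ _
  have hlad : ∀ x : Fin (k+3) × V, (x.2 = w ∨ x.2 = m w) → σ.SameCycle b x := fun x hx =>
    auxLadder c m hm hc σ w (fun z hz => h.out z (by rcases hz with e | e <;> rw [e] <;> assumption))
      b x (Or.inl hb2) hx
  have hab : ¬ σ.SameCycle a b := by
    intro hs
    obtain ⟨j, hj⟩ := hs.symm.exists_nat_pow_eq
    have : ∀ j : ℕ, ((σ ^ j) b).2 ∉ A := by
      intro j
      induction j with
      | zero => simpa [hb2] using hw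
      | succ j ih =>
        rw [pow_succ', Equiv.Perm.mul_apply, h.out _ ih]
        rcases auxStep_snd c m ((σ ^ j) b) with e | e <;> rw [e]
        · exact ih
        · exact fun h' => ih (by simpa [hm] using h.clo _ h')
    apply this j
    rw [hj, ha2]; exact hu
  have hba : ¬ σ.SameCycle b a := fun e => hab e.symm
  refine ⟨σ * Equiv.swap a b, ?_⟩
  have hsa : (σ * Equiv.swap a b) a = auxTgt c i w := by simp [hwt]
  have hsb : (σ * Equiv.swap a b) b = auxTgt c i u := by simp [hi]
  have hso : ∀ x, x ≠ a → x ≠ b → (σ * Equiv.swap a b) x = σ x := by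
    intro x h1 h2
    rw [Equiv.Perm.mul_apply, Equiv.swap_apply_of_ne_of_ne h1 h2]
  have hso2 : ∀ x : Fin (k+3) × V, x.2 ≠ u → x.2 ≠ w → (σ * Equiv.swap a b) x = σ x := by
    intro x h1 h2
    exact hso x (fun e => h1 (e ▸ ha2)) (fun e => h2 (e ▸ hb2))
  have hor : ∀ v, (v = u ∨ v = w) → (∀ j : Fin (k+2), (j = 0 ∨ j = 1) → σ (auxSrc c j v) = auxTgt c j v) →
      ((σ * Equiv.swap a b) (auxSrc c 0 v) = auxTgt c 0 v ∨
       (σ * Equiv.swap a b) (auxSrc c 1 v) = auxTgt c 1 v) := by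
    intro v hv hj
    have hne : ∀ j j' : Fin (k+2), (∀ v, auxSrc c j v ≠ auxSrc c j' v) → ∀ v' , auxSrc c j v ≠ auxSrc c j' v' := by
      intro j j' hjj v' e
      have : v = v' := by have := congrArg Prod.snd e; simpa [auxSrc_snd] using this
      subst this
      exact hjj _ e
    rcases hi01 with e | e
    · right
      rw [hso, hj 1 (Or.inr rfl)]
      · rw [ha, e]; exact hne _ _ (fun v => (auxSrc_ne c v).symm) _
      · rw [hb, e]; exact hne _ _ (fun v => (auxSrc_ne c v).symm) _
    · left
      rw [hso, hj 0 (Or.inl rfl)]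
      · rw [ha, e]; exact hne _ _ (fun v => (auxSrc_ne c v)) _
      · rw [hb, e]; exact hne _ _ (fun v => (auxSrc_ne c v)) _
  have hout : ∀ v, v ∉ A → ∀ j, σ (auxSrc c j v) = auxTgt c j v := by
    intro v hv j
    rw [h.out _ (by rw [auxSrc_snd]; exact hv), auxStep_src]
  constructor
  · intro x
    by_cases hxa : x = a
    · rw [hxa, hsa, boxProd_adj]
      right
      refine ⟨by rw [ha2, auxTgt_snd]; exact huw, auxSrc_fst c i u w hcuw⟩
    by_cases hxb : x = b
    · rw [hxb, hsb, boxProd_adj]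
      right
      refine ⟨by rw [hb2, auxTgt_snd]; exact huw.symm, auxSrc_fst c i w u hcuw.symm⟩
    rw [hso x hxa hxb]
    exact h.adj x
  · rintro v (rfl | rfl | hv)
    · simp
    · simp [hm]
    · simp [h.clo v hv]
  · have hall : ∀ x : Fin (k+3) × V, x.2 ∈ insert w (insert (m w) A) →
        (σ * Equiv.swap a b).SameCycle a x := by
      intro x hx
      have hAB : (σ * Equiv.swap a b).SameCycle a b :=
        aux_merge σ a b hab b (Equiv.Perm.SameCycle.refl _ _)
      rcases hx with hx | hx | hx
      · exact aux_merge σ a b hab x (hlad x (Or.inl hx))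
      · exact aux_merge σ a b hab x (hlad x (Or.inr hx))
      · have := aux_merge σ b a hba x (h.cyc a x (by rw [ha2]; exact hu) hx)
        rw [Equiv.swap_comm] at this
        exact hAB.trans this
    intro x y hx hy
    exact (hall x hx).symm.trans (hall y hy)
  · intro x hx
    have h1 : x.2 ∉ A := fun e => hx (Or.inr (Or.inr e))
    rw [hso2 x (fun e => h1 (e ▸ hu)) (fun e => hx (Or.inl e)), h.out x h1]
  · intro v hv
    by_cases hvu : v = u
    · subst hvu
      rcases h.free v hu with h' | ⟨-, z, hzA, hz, hzm⟩ | h'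
      · right; left
        refine ⟨hor v (Or.inl rfl) (by rintro j (rfl | rfl); exacts [h'.1, h'.2]), w, by simp, huw, ?_⟩
        exact fun e => hw (e ▸ h.clo v hu)
      · right; right
        have hzw : z ≠ w := fun e => hw (e ▸ hzA)
        have hmw' : m v ≠ w := fun e => hw (e ▸ h.clo v hu)
        have hN : ({m v, z, w} : Finset V) = G.neighborFinset v := by
          apply Finset.eq_of_subset_of_card_le
          · intro t ht
            simp at ht
            rcases ht with rfl | rfl | rfl <;> simp [hG, hz, huw]
          · rw [card_neighborFinset_eq_degree, hreg.degree_eq,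
              Finset.card_eq_three.2 ⟨m v, z, w, hzm.symm, hmw', hzw, rfl⟩]
        intro t ht
        have : t ∈ G.neighborFinset v := by simpa using ht
        rw [← hN] at this
        simp at this
        rcases this with rfl | rfl | rfl
        · simp [h.clo v hu]
        · simp [hzA]
        · simp
      · exact absurd (h' w huw) hw
    by_cases hvw : v = w
    · subst hvw
      right; left
      exact ⟨hor v (Or.inr rfl) (fun j _ => hout v hw j), u, by simp [hu], huw.symm, hmuw.symm⟩
    have hs : ∀ j, (σ * Equiv.swap a b) (auxSrc c j v) = σ (auxSrc c j v) := fun j =>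
      hso2 _ (by rwa [auxSrc_snd]) (by rwa [auxSrc_snd])
    rw [hs, hs]
    rcases hv with hv | hv | hv
    · exact absurd hv hvw
    · subst hv
      exact Or.inl ⟨hout _ hmw _, hout _ hmw _⟩
    · rcases h.free v hv with h' | ⟨h', z, hzA, hz⟩ | h'
      · exact Or.inl h'
      · exact Or.inr (Or.inl ⟨h', z, by simp [hzA], hz⟩)
      · exact Or.inr (Or.inr fun z hz => by simp [h' z hz])

end

lemma aux_main {V : Type*} [Fintype V] [DecidableEq V] (G : SimpleGraph V) [DecidableRel G.Adj]
    (hreg : G.IsRegularOfDegree 3) (hconn : G.Connected) (M : G.Subgraph)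
    (hM : M.IsPerfectMatching) (hac : M.spanningCoe.IsAcyclic) (k : ℕ) :
    ∃ σ : Equiv.Perm (Fin (k+3) × V), (∀ x, (pathGraph (k+3) □ G).Adj x (σ x)) ∧
      ∀ x y, σ.SameCycle x y := by
  classical
  obtain ⟨T, hMT, hTG, hT⟩ := hconn.exists_isTree_le_of_le_of_isAcyclic M.spanningCoe_le hac
  rw [Subgraph.isPerfectMatching_iff] at hM
  choose m hm1 hm2 using fun v => (hM v)
  have hm : ∀ v, m (m v) = v := fun v => ((hm2 (m v)) v (hm1 v).symm).symm
  have hG : ∀ v, G.Adj v (m v) := fun v => (hm1 v).adj_sub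
  let col := hT.coloringTwo
  let c : V → Bool := fun v => decide (col v = 0)
  have hcT : ∀ u v, T.Adj u v → c u ≠ c v := by
    intro u v huv
    have := col.valid huv
    simp only [c]
    generalize col u = x at *
    generalize col v = y at *
    revert x y; decide
  have hc : ∀ v, c (m v) = !c v := by
    intro v
    have := hcT v (m v) (hMT (hm1 v))
    rcases h1 : c v <;> rcases h2 : c (m v) <;> simp_all
  obtain ⟨v0⟩ := hconn.nonempty
  obtain ⟨A, hA⟩ := Set.Finite.exists_maximal
    (s := {A : Set V | A.Nonempty ∧ ∃ σ, AuxGood (k := k) G c m σ A}) (Set.toFinite _)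
    ⟨{v0, m v0}, by simp, _, auxGood_base G c m hm hc hG v0⟩
  obtain ⟨⟨⟨u0, hu0⟩, σ, hσ⟩, hmax⟩ := hA
  have hAll : ∀ v, v ∈ A := by
    by_contra! hcon
    obtain ⟨v, hv⟩ := hcon
    obtain ⟨p⟩ := hT.connected.preconnected u0 v
    obtain ⟨d, -, hd1, hd2⟩ := p.exists_boundary_dart A hu0 hv
    obtain ⟨σ', hσ'⟩ := auxGood_step G hreg c m hm hc hG σ A hσ d.fst d.snd hd1 hd2
      (hTG d.adj) (hcT _ _ d.adj)
    exact hd2 (hmax ⟨⟨u0, by simp [hu0]⟩, σ', hσ'⟩ (by intro x hx; simp [hx]) (by simp))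
  exact ⟨σ, hσ.adj, fun x y => hσ.cyc x y (hAll _) (hAll _)⟩

theorem stmt10 {V₁ V₂ : Type*} [Fintype V₁] [Fintype V₂] [DecidableEq V₁] [DecidableEq V₂]
    (G₁ : SimpleGraph V₁) (G₂ : SimpleGraph V₂) [DecidableRel G₂.Adj]
    (hcard : 3 ≤ Fintype.card V₁) (hG₁ : G₁.Traceable)
    (hconn : G₂.Connected) (hreg : G₂.IsRegularOfDegree 3)
    (hbridge : ∀ e ∈ G₂.edgeSet, ¬ G₂.IsBridge e) :
    (G₁ □ G₂).IsHamiltonian := by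
  obtain ⟨M, hM⟩ := aux_petersen G₂ hreg hbridge
  obtain ⟨a, b, p, hp⟩ := hG₁
  have hlen := hp.length_support
  obtain ⟨k, hk⟩ : ∃ k, p.support.length = k + 3 := ⟨_, (Nat.sub_add_cancel (hlen ▸ hcard)).symm⟩
  have hk' : p.length = k + 2 := by
    have := p.length_support
    omega
  obtain ⟨σ, hσ, hcyc⟩ := aux_main G₂ hreg hconn M hM (aux_matching_acyclic G₂ M hM) k
  let e : Fin (k+3) ≃ V₁ := (finCongr hk.symm).trans hp.getVertEquiv
  have he : ∀ i : Fin (k+3), e i = p.getVert i.val := fun i => rfl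
  have hadj : ∀ i j : Fin (k+3), i.val + 1 = j.val → G₁.Adj (e i) (e j) := by
    intro i j h
    rw [he, he, ← h]
    exact p.adj_getVert_succ (by omega)
  have hH : (pathGraph (k+3) □ G₂).IsHamiltonian := by
    apply aux_ham _ σ hσ hcyc
    obtain ⟨v⟩ := hconn.nonempty
    have : 0 < Fintype.card V₂ := Fintype.card_pos_iff.2 ⟨v⟩
    rw [Fintype.card_prod, Fintype.card_fin]
    nlinarith
  let f : (pathGraph (k+3) □ G₂) →g (G₁ □ G₂) :=
    { toFun := fun x => (e x.1, x.2)
      map_rel' := by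
        rintro ⟨i, v⟩ ⟨j, w⟩ h
        rw [boxProd_adj] at h ⊢
        rcases h with ⟨h, h'⟩ | ⟨h, h'⟩
        · left
          refine ⟨?_, h'⟩
          rw [pathGraph_adj] at h
          rcases h with h | h
          · exact hadj _ _ h
          · exact (hadj _ _ h).symm
        · right
          exact ⟨h, congrArg e h'⟩ }
  have hf : Function.Bijective f := (e.prodCongr (Equiv.refl V₂)).bijective
  intro hne
  obtain ⟨x, q, hq⟩ := hH (by rwa [Fintype.card_of_bijective hf])
  exact ⟨_, _, hq.map (f := f) hf⟩
end

section
/- Let G1 be a traceable graph of even order and G2 a connected graph with a path factor. If |V(G1)| ≥ 4Δ(G2) − 2, then G1 □ G2 is Hamiltonian. -/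
open SimpleGraph

/-- `H` is a single cycle on the vertex set `S`, inside `K`. -/
structure CycOn {W : Type*} (K H : SimpleGraph W) (S : Set W) : Prop where
  deg : ∀ x ∈ S, ∃ y z, y ≠ z ∧ ∀ w, H.Adj x w ↔ w = y ∨ w = z
  supp : ∀ x w, H.Adj x w → x ∈ S
  conn : ∀ x ∈ S, ∀ y ∈ S, H.Reachable x y
  le : H ≤ K

lemma CycOn.isCycles {W : Type*} {K H : SimpleGraph W} {S : Set W} (h : CycOn K H S) :
    H.IsCycles := by
  intro v hv
  obtain ⟨w, hw⟩ := hv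
  obtain ⟨y, z, hyz, hh⟩ := h.deg v (h.supp v w hw)
  rw [Set.ncard_eq_two]
  exact ⟨y, z, hyz, by ext w; simp [hh]⟩

lemma reach_delete {W : Type*} {H : SimpleGraph W} {x y : W}
    (h : (H.deleteEdges {s(x, y)}).Reachable x y) {p q : W} (hpq : H.Reachable p q) :
    (H.deleteEdges {s(x, y)}).Reachable p q := by
  obtain ⟨w⟩ := hpq
  induction w with
  | nil => rfl
  | @cons a b c hab _ ih =>
    refine Reachable.trans ?_ ih
    by_cases hs : s(a, b) = s(x, y)
    · rcases Sym2.eq_iff.1 hs with ⟨rfl, rfl⟩ | ⟨rfl, rfl⟩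
      · exact h
      · exact h.symm
    · exact Adj.reachable (by rw [deleteEdges_adj]; exact ⟨hab, hs⟩)

lemma CycOn.merge {W : Type*} [Finite W] {K H₁ H₂ : SimpleGraph W} {S T : Set W}
    (h₁ : CycOn K H₁ S) (h₂ : CycOn K H₂ T) (hST : Disjoint S T) {x y x' y' : W}
    (hxy : H₁.Adj x y) (hxy' : H₂.Adj x' y') (hx : K.Adj x x') (hy : K.Adj y y') :
    ∃ H, CycOn K H (S ∪ T) ∧ (∀ p q, H₁.Adj p q → s(p, q) ≠ s(x, y) → H.Adj p q) ∧
      (∀ p q, H₂.Adj p q → s(p, q) ≠ s(x', y') → H.Adj p q) := by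
  have hxS := h₁.supp _ _ hxy
  have hyS := h₁.supp _ _ hxy.symm
  have hxT := h₂.supp _ _ hxy'
  have hyT := h₂.supp _ _ hxy'.symm
  have hd : ∀ p, p ∈ S → p ∈ T → False := fun p h h' => Set.disjoint_left.1 hST h h'
  have hdel1 := h₁.isCycles.reachable_deleteEdges hxy
  have hdel2 := h₂.isCycles.reachable_deleteEdges hxy'
  have nxy := hxy.ne
  have nxy' := hxy'.ne
  have n1 : x ≠ x' := hx.ne
  have n2 : y ≠ y' := hy.ne
  let H := H₁.deleteEdges {s(x, y)} ⊔ H₂.deleteEdges {s(x', y')} ⊔ edge x x' ⊔ edge y y'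
  have hH : ∀ p q, H.Adj p q ↔ (H₁.Adj p q ∧ ¬ ((p = x ∧ q = y) ∨ (p = y ∧ q = x))) ∨
      (H₂.Adj p q ∧ ¬ ((p = x' ∧ q = y') ∨ (p = y' ∧ q = x'))) ∨
      ((p = x ∧ q = x') ∨ (p = x' ∧ q = x)) ∨ ((p = y ∧ q = y') ∨ (p = y' ∧ q = y)) := by
    intro p q
    simp only [H, sup_adj, deleteEdges_adj, edge_adj, Set.mem_singleton_iff, Sym2.eq_iff]
    grind
  have l1 : H₁.deleteEdges {s(x, y)} ≤ H := le_sup_of_le_left (le_sup_of_le_left le_sup_left)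
  have l2 : H₂.deleteEdges {s(x', y')} ≤ H := le_sup_of_le_left (le_sup_of_le_left le_sup_right)
  have r1 : ∀ p ∈ S, H.Reachable p x := fun p hp =>
    (reach_delete hdel1 (h₁.conn p hp x hxS)).mono l1
  have r2 : ∀ p ∈ T, H.Reachable p x := fun p hp =>
    ((reach_delete hdel2 (h₂.conn p hp x' hxT)).mono l2).trans
      (Adj.reachable (by rw [hH]; simp))
  have r3 : ∀ p ∈ S ∪ T, H.Reachable p x := by
    rintro p (hp | hp)
    · exact r1 p hp
    · exact r2 p hp
  refine ⟨H, ⟨?_, ?_, fun p hp q hq => (r3 p hp).trans (r3 q hq).symm, ?_⟩, ?_, ?_⟩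
  · rintro p (hp | hp)
    · have hp2 : ∀ w, ¬ H₂.Adj p w := fun w hw => hd p hp (h₂.supp _ _ hw)
      have hp3 : p ≠ x' := by rintro rfl; exact hd _ hp hxT
      have hp4 : p ≠ y' := by rintro rfl; exact hd _ hp hyT
      obtain ⟨a, b, hab, hh⟩ := h₁.deg p hp
      have hr : ∀ w, H₁.Adj p w → w ≠ x' ∧ w ≠ y' := by
        intro w hw
        constructor <;> rintro rfl
        · exact hd _ (h₁.supp _ _ hw.symm) hxT
        · exact hd _ (h₁.supp _ _ hw.symm) hyT
      simp only [hH]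
      by_cases e1 : p = x
      · subst e1
        have := (hh y).1 hxy
        rcases this with e | e
        · exact ⟨x', b, by grind, by grind⟩
        · exact ⟨x', a, by grind, by grind⟩
      · by_cases e2 : p = y
        · subst e2
          have := (hh x).1 hxy.symm
          rcases this with e | e
          · exact ⟨y', b, by grind, by grind⟩
          · exact ⟨y', a, by grind, by grind⟩
        · exact ⟨a, b, hab, by grind⟩
    · have hp2 : ∀ w, ¬ H₁.Adj p w := fun w hw => hd p (h₁.supp _ _ hw) hp
      have hp3 : p ≠ x := by rintro rfl; exact hd _ hxS hp
      have hp4 : p ≠ y := by rintro rfl; exact hd _ hyS hp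
      obtain ⟨a, b, hab, hh⟩ := h₂.deg p hp
      have hr : ∀ w, H₂.Adj p w → w ≠ x ∧ w ≠ y := by
        intro w hw
        constructor <;> rintro rfl
        · exact hd _ hxS (h₂.supp _ _ hw.symm)
        · exact hd _ hyS (h₂.supp _ _ hw.symm)
      simp only [hH]
      by_cases e1 : p = x'
      · subst e1
        have := (hh y').1 hxy'
        rcases this with e | e
        · exact ⟨x, b, by grind, by grind⟩
        · exact ⟨x, a, by grind, by grind⟩
      · by_cases e2 : p = y'
        · subst e2
          have := (hh x').1 hxy'.symm
          rcases this with e | e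
          · exact ⟨y, b, by grind, by grind⟩
          · exact ⟨y, a, by grind, by grind⟩
        · exact ⟨a, b, hab, by grind⟩
  · intro p w hpw
    rw [hH] at hpw
    have := h₁.supp p w
    have := h₂.supp p w
    simp only [Set.mem_union]
    grind
  · intro p q hpq
    rw [hH] at hpq
    have := @h₁.le p q
    have := @h₂.le p q
    have := hx.symm
    have := hy.symm
    grind
  · intro p q hpq hs
    rw [hH]
    rw [Ne, Sym2.eq_iff] at hs
    exact Or.inl ⟨hpq, hs⟩
  · intro p q hpq hs
    rw [hH]
    rw [Ne, Sym2.eq_iff] at hs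
    exact Or.inr (Or.inl ⟨hpq, hs⟩)

lemma CycOn.isHamiltonian {W : Type*} [Fintype W] [DecidableEq W] [Nonempty W]
    {K H : SimpleGraph W} (h : CycOn K H Set.univ) : K.IsHamiltonian := by
  intro _
  obtain ⟨v⟩ := ‹Nonempty W›
  obtain ⟨y, z, hyz, hh⟩ := h.deg v trivial
  obtain ⟨p, hp, hv⟩ := h.isCycles.exists_cycle_toSubgraph_verts_eq_connectedComponentSupp
    (c := H.connectedComponentMk v) (v := v) rfl ⟨y, (hh y).2 (Or.inl rfl)⟩
  have hall : ∀ w, w ∈ p.support := by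
    intro w
    rw [← Walk.mem_verts_toSubgraph, hv]
    exact ConnectedComponent.eq.2 (h.conn w trivial v trivial)
  have hH : p.IsHamiltonianCycle := by
    refine ⟨hp, hp.isPath_tail.isHamiltonian_of_mem fun w => ?_⟩
    rw [Walk.support_tail_of_not_nil _ hp.not_nil]
    have := hall w
    rw [← Walk.cons_tail_support, List.mem_cons] at this
    rcases this with rfl | h
    · exact Walk.end_mem_tail_support hp.not_nil
    · exact h
  exact ⟨v, p.map (.ofLE h.le), hH.map Function.bijective_id⟩

/-- Graph on `Fin n × V` with prescribed vertical and horizontal edges. -/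
def gridG {V : Type*} (n : ℕ) (P : V → ℕ → Prop) (Q : V → V → ℕ → Prop)
    (hQ : ∀ u i, ¬ Q u u i) : SimpleGraph (Fin n × V) where
  Adj x w := (x.2 = w.2 ∧ ((x.1.val + 1 = w.1.val ∧ P x.2 x.1.val) ∨
      (w.1.val + 1 = x.1.val ∧ P x.2 w.1.val))) ∨
    (x.1 = w.1 ∧ (Q x.2 w.2 x.1.val ∨ Q w.2 x.2 x.1.val))
  symm := ⟨by
    rintro ⟨i, u⟩ ⟨j, v⟩ h
    simp only at h ⊢
    grind⟩
  loopless := ⟨by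
    rintro ⟨i, u⟩ h
    simp only at h
    grind⟩

lemma block_two {V : Type*} {G : SimpleGraph V} {n : ℕ} (hn : 2 ≤ n) {a b : V}
    (hab : G.Adj a b) :
    ∃ H, CycOn (pathGraph n □ G) H {x : Fin n × V | x.2 = a ∨ x.2 = b} ∧
      ∀ u, (u = a ∨ u = b) → ∀ i (h : i + 1 < n),
        H.Adj (⟨i, by omega⟩, u) (⟨i + 1, h⟩, u) := by
  classical
  have nab := hab.ne
  let P : V → ℕ → Prop := fun u _ => u = a ∨ u = b
  let Q : V → V → ℕ → Prop := fun u w r => u = a ∧ w = b ∧ (r = 0 ∨ r + 1 = n)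
  refine ⟨gridG n P Q (by simp only [Q]; grind), ⟨?_, ?_, ?_, ?_⟩, ?_⟩
  · rintro ⟨⟨r, hr⟩, u⟩ hu
    simp only [Set.mem_ofPred_eq] at hu
    simp only [gridG, P, Q]
    by_cases h0 : r = 0
    · refine ⟨(⟨r + 1, by omega⟩, u), (⟨r, hr⟩, if u = a then b else a), by grind, ?_⟩
      rintro ⟨⟨s, hs⟩, w⟩
      simp only [Prod.mk.injEq, Fin.mk.injEq]
      grind
    · by_cases h1 : r + 1 = n
      · refine ⟨(⟨r - 1, by omega⟩, u), (⟨r, hr⟩, if u = a then b else a), by grind, ?_⟩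
        rintro ⟨⟨s, hs⟩, w⟩
        simp only [Prod.mk.injEq, Fin.mk.injEq]
        grind
      · refine ⟨(⟨r - 1, by omega⟩, u), (⟨r + 1, by omega⟩, u), by grind, ?_⟩
        rintro ⟨⟨s, hs⟩, w⟩
        simp only [Prod.mk.injEq, Fin.mk.injEq]
        grind
  · rintro ⟨⟨r, hr⟩, u⟩ ⟨⟨s, hs⟩, w⟩ h
    simp only [gridG, P, Q, Set.mem_ofPred_eq, Fin.mk.injEq] at h ⊢
    grind
  · suffices h : ∀ r (hr : r < n), ∀ u, (u = a ∨ u = b) →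
        (gridG n P Q (by simp only [Q]; grind)).Reachable (⟨r, hr⟩, u) (⟨0, by omega⟩, a) by
      rintro ⟨⟨r, hr⟩, u⟩ hu ⟨⟨s, hs⟩, w⟩ hw
      exact (h r hr u hu).trans (h s hs w hw).symm
    intro r
    induction r with
    | zero =>
      rintro hr u (rfl | rfl)
      · rfl
      · exact Adj.reachable (by simp [gridG, P, Q])
    | succ r ih =>
      intro hr u hu
      refine Reachable.trans (Adj.reachable ?_) (ih (by omega) u hu)
      simp [gridG, P, Q, hu]
  · rintro ⟨⟨r, hr⟩, u⟩ ⟨⟨s, hs⟩, w⟩ h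
    simp only [gridG, P, Q, boxProd_adj, pathGraph_adj, Fin.mk.injEq] at h ⊢
    have := hab.symm
    grind
  · intro u hu i h
    simp [gridG, P, hu]

lemma block_three {V : Type*} {G : SimpleGraph V} {n : ℕ} (hn : 2 ≤ n) (he : Even n) {a b c : V}
    (hab : G.Adj a b) (hbc : G.Adj b c) (nac : a ≠ c) (t : ℕ → Prop) :
    ∃ H, CycOn (pathGraph n □ G) H {x : Fin n × V | x.2 = a ∨ x.2 = b ∨ x.2 = c} ∧
      ∀ u i (h : i + 1 < n), ((u = a ∧ (i % 2 = 0 ∨ t i)) ∨ (u = c ∧ (i % 2 = 0 ∨ ¬ t i)) ∨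
          (u = b ∧ i % 2 = 1)) →
        H.Adj (⟨i, by omega⟩, u) (⟨i + 1, h⟩, u) := by
  classical
  have nab := hab.ne
  have nbc := hbc.ne
  have he' : n % 2 = 0 := Nat.even_iff.1 he
  let g : ℕ → ℕ := fun r => if r % 2 = 1 then r else r - 1
  let P : V → ℕ → Prop := fun u i => (u = a ∧ (i % 2 = 0 ∨ t i)) ∨
    (u = c ∧ (i % 2 = 0 ∨ ¬ t i)) ∨ (u = b ∧ i % 2 = 1)
  let Q : V → V → ℕ → Prop := fun u w r =>
    (u = a ∧ w = b ∧ (r = 0 ∨ r + 1 = n ∨ ¬ t (g r))) ∨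
    (u = b ∧ w = c ∧ (r = 0 ∨ r + 1 = n ∨ t (g r)))
  refine ⟨gridG n P Q (by simp only [Q]; grind), ⟨?_, ?_, ?_, ?_⟩, ?_⟩
  · rintro ⟨⟨r, hr⟩, u⟩ hu
    simp only [Set.mem_ofPred_eq] at hu
    simp only [gridG, P, Q, g]
    rcases hu with rfl | rfl | rfl
    · by_cases hr2 : r % 2 = 0
      · by_cases hQ : r = 0 ∨ ¬ t (r - 1)
        · refine ⟨(⟨r + 1, by omega⟩, u), (⟨r, hr⟩, b), by grind, ?_⟩
          rintro ⟨⟨s, hs⟩, w⟩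
          simp only [Prod.mk.injEq, Fin.mk.injEq]
          grind
        · refine ⟨(⟨r + 1, by omega⟩, u), (⟨r - 1, by omega⟩, u), by grind, ?_⟩
          rintro ⟨⟨s, hs⟩, w⟩
          simp only [Prod.mk.injEq, Fin.mk.injEq]
          grind
      · by_cases hQ : r + 1 = n ∨ ¬ t r
        · refine ⟨(⟨r - 1, by omega⟩, u), (⟨r, hr⟩, b), by grind, ?_⟩
          rintro ⟨⟨s, hs⟩, w⟩
          simp only [Prod.mk.injEq, Fin.mk.injEq]
          grind
        · refine ⟨(⟨r - 1, by omega⟩, u), (⟨r + 1, by omega⟩, u), by grind, ?_⟩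
          rintro ⟨⟨s, hs⟩, w⟩
          simp only [Prod.mk.injEq, Fin.mk.injEq]
          grind
    · by_cases hr0 : r = 0 ∨ r + 1 = n
      · refine ⟨(⟨r, hr⟩, a), (⟨r, hr⟩, c), by grind, ?_⟩
        rintro ⟨⟨s, hs⟩, w⟩
        simp only [Prod.mk.injEq, Fin.mk.injEq]
        grind
      · by_cases hr2 : r % 2 = 0
        · refine ⟨(⟨r - 1, by omega⟩, u), (⟨r, hr⟩, if t (r - 1) then c else a), by grind, ?_⟩
          rintro ⟨⟨s, hs⟩, w⟩
          simp only [Prod.mk.injEq, Fin.mk.injEq]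
          grind
        · refine ⟨(⟨r + 1, by omega⟩, u), (⟨r, hr⟩, if t r then c else a), by grind, ?_⟩
          rintro ⟨⟨s, hs⟩, w⟩
          simp only [Prod.mk.injEq, Fin.mk.injEq]
          grind
    · by_cases hr2 : r % 2 = 0
      · by_cases hQ : r = 0 ∨ t (r - 1)
        · refine ⟨(⟨r + 1, by omega⟩, u), (⟨r, hr⟩, b), by grind, ?_⟩
          rintro ⟨⟨s, hs⟩, w⟩
          simp only [Prod.mk.injEq, Fin.mk.injEq]
          grind
        · refine ⟨(⟨r + 1, by omega⟩, u), (⟨r - 1, by omega⟩, u), by grind, ?_⟩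
          rintro ⟨⟨s, hs⟩, w⟩
          simp only [Prod.mk.injEq, Fin.mk.injEq]
          grind
      · by_cases hQ : r + 1 = n ∨ t r
        · refine ⟨(⟨r - 1, by omega⟩, u), (⟨r, hr⟩, b), by grind, ?_⟩
          rintro ⟨⟨s, hs⟩, w⟩
          simp only [Prod.mk.injEq, Fin.mk.injEq]
          grind
        · refine ⟨(⟨r - 1, by omega⟩, u), (⟨r + 1, by omega⟩, u), by grind, ?_⟩
          rintro ⟨⟨s, hs⟩, w⟩
          simp only [Prod.mk.injEq, Fin.mk.injEq]
          grind
  · rintro ⟨⟨r, hr⟩, u⟩ ⟨⟨s, hs⟩, w⟩ h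
    simp only [gridG, P, Q, Set.mem_ofPred_eq, Fin.mk.injEq] at h ⊢
    grind
  · suffices h : ∀ r (hr : r < n), ∀ u, (u = a ∨ u = b ∨ u = c) →
        (gridG n P Q (by simp only [Q]; grind)).Reachable (⟨r, hr⟩, u) (⟨0, by omega⟩, b) by
      rintro ⟨⟨r, hr⟩, u⟩ hu ⟨⟨s, hs⟩, w⟩ hw
      exact (h r hr u hu).trans (h s hs w hw).symm
    intro r
    induction r with
    | zero =>
      rintro hr u (rfl | rfl | rfl)
      · exact Adj.reachable (by simp [gridG, P, Q])
      · rfl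
      · exact Adj.reachable (by simp [gridG, P, Q])
    | succ r ih =>
      intro hr
      have up : ∀ u, (u = a ∨ u = b ∨ u = c) → P u r →
          (gridG n P Q (by simp only [Q]; grind)).Reachable (⟨r + 1, hr⟩, u) (⟨0, by omega⟩, b) := by
        intro u hu hP
        refine Reachable.trans (Adj.reachable ?_) (ih (by omega) u hu)
        simp [gridG, hP]
      have hz : ∀ u v, Q u v (r + 1) ∨ Q v u (r + 1) →
          (gridG n P Q (by simp only [Q]; grind)).Reachable (⟨r + 1, hr⟩, u) (⟨r + 1, hr⟩, v) := by
        intro u v h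
        exact Adj.reachable (by simp [gridG, h])
      by_cases h2 : r % 2 = 0
      · have ha := up a (by simp) (by simp [P, h2])
        have hc := up c (by simp) (by simp [P, h2])
        have hb : (gridG n P Q (by simp only [Q]; grind)).Reachable
            (⟨r + 1, hr⟩, b) (⟨0, by omega⟩, b) := by
          by_cases ht : t (r + 1)
          · exact (hz b c (by simp only [Q, g]; grind)).trans hc
          · exact (hz b a (by simp only [Q, g]; grind)).trans ha
        rintro u (rfl | rfl | rfl) <;> assumption
      · have hb := up b (by simp) (by simp only [P]; grind)
        by_cases ht : t r
        · have ha := up a (by simp) (by simp [P, ht])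
          have hc := (hz c b (by simp only [Q, g]; grind)).trans hb
          rintro u (rfl | rfl | rfl) <;> assumption
        · have hc := up c (by simp) (by simp [P, ht])
          have ha := (hz a b (by simp only [Q, g]; grind)).trans hb
          rintro u (rfl | rfl | rfl) <;> assumption
  · rintro ⟨⟨r, hr⟩, u⟩ ⟨⟨s, hs⟩, w⟩ h
    simp only [gridG, P, Q, boxProd_adj, pathGraph_adj, Fin.mk.injEq] at h ⊢
    have := hab.symm
    have := hbc.symm
    grind
  · intro u i h hu
    simp [gridG, P, hu]

inductive Blk (V : Type*) where
  | two (a b : V) : Blk V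
  | three (a b c : V) : Blk V

def Blk.verts {V : Type*} : Blk V → Set V
  | .two a b => {u | u = a ∨ u = b}
  | .three a b c => {u | u = a ∨ u = b ∨ u = c}

def Blk.Valid {V : Type*} (G : SimpleGraph V) : Blk V → Prop
  | .two a b => G.Adj a b
  | .three a b c => G.Adj a b ∧ G.Adj b c ∧ a ≠ c

def Blk.Feas {V : Type*} (A : V → Set ℕ) : Blk V → Prop
  | .two _ _ => True
  | .three a b c => (∀ i ∈ A b, i % 2 = 1) ∧ ∀ i, i % 2 = 1 → i ∈ A a → i ∈ A c → False

/-- `v` is the center of the block. -/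
def Blk.Cen {V : Type*} (v : V) : Blk V → Prop
  | .two _ _ => False
  | .three _ b _ => v = b

lemma Blk.cyc {V : Type*} {G : SimpleGraph V} {n : ℕ} (hn : 2 ≤ n) (he : Even n) (B : Blk V)
    (hB : B.Valid G) (A : V → Set ℕ) (hA : B.Feas A) :
    ∃ H, CycOn (pathGraph n □ G) H {x : Fin n × V | x.2 ∈ B.verts} ∧
      ∀ u ∈ B.verts, ∀ i (h : i + 1 < n), i ∈ A u →
        H.Adj (⟨i, by omega⟩, u) (⟨i + 1, h⟩, u) := by
  cases B with
  | two a b =>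
    obtain ⟨H, h1, h2⟩ := block_two (G := G) hn hB
    exact ⟨H, h1, fun u hu i h _ => h2 u hu i h⟩
  | three a b c =>
    obtain ⟨hab, hbc, hac⟩ := hB
    obtain ⟨H, h1, h2⟩ := block_three (G := G) hn he hab hbc hac (fun i => i ∈ A a)
    refine ⟨H, h1, fun u hu i h hi => h2 u i h ?_⟩
    obtain ⟨f1, f2⟩ := hA
    have f1 := f1 i
    have f2 := f2 i
    rcases hu with rfl | rfl | rfl
    · exact Or.inl ⟨rfl, Or.inr hi⟩
    · exact Or.inr (Or.inr ⟨rfl, f1 hi⟩)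
    · refine Or.inr (Or.inl ⟨rfl, ?_⟩)
      by_cases h2 : i % 2 = 0
      · exact Or.inl h2
      · exact Or.inr fun h3 => f2 (by omega) h3 hi

/-- A tiling of `S` by blocks. -/
def Tiling {V : Type*} (G : SimpleGraph V) (S : Set V) (f : V → Blk V) : Prop :=
  ∀ v ∈ S, v ∈ (f v).verts ∧ (f v).verts ⊆ S ∧ (f v).Valid G ∧ ∀ w ∈ (f v).verts, f w = f v

lemma Blk.feas_congr {V : Type*} {A A' : V → Set ℕ} {B : Blk V}
    (h : ∀ u ∈ B.verts, A u = A' u) (hA : B.Feas A) : B.Feas A' := by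
  cases B with
  | two a b => trivial
  | three a b c =>
    have ha := h a (Or.inl rfl)
    have hb := h b (Or.inr (Or.inl rfl))
    have hc := h c (Or.inr (Or.inr rfl))
    simpa only [Blk.Feas, ha, hb, hc] using hA

/-- The inductive invariant. -/
structure GInv {V : Type*} [Fintype V] [DecidableEq V] (G : SimpleGraph V) (n : ℕ)
    (f : V → Blk V) (S : Set V) (U : V → Finset ℕ) : Prop where
  closed : ∀ v ∈ S, (f v).verts ⊆ S
  empty : ∀ v, v ∉ S → U v = ∅
  card : ∀ v, (U v).card ≤ {w | G.Adj v w ∧ w ∈ S ∧ w ∉ (f v).verts}.ncard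
  feas : ∀ v, (f v).Feas (fun u => (U u : Set ℕ))
  cyc : ∀ A : V → Set ℕ, (∀ v, (f v).Feas A) → (∀ v, (U v : Set ℕ) ⊆ A v) →
    ∃ H, CycOn (pathGraph n □ G) H {x : Fin n × V | x.2 ∈ S} ∧
      ∀ u ∈ S, ∀ i (h : i + 1 < n), i ∈ A u → i ∉ U u →
        H.Adj (⟨i, by omega⟩, u) (⟨i + 1, h⟩, u)

lemma inv_base {V : Type*} [Fintype V] [DecidableEq V] {G : SimpleGraph V} {n : ℕ}
    (hn : 2 ≤ n) (he : Even n)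
    {f : V → Blk V} (hf : Tiling G Set.univ f) (v : V) :
    GInv G n f (f v).verts (fun _ => ∅) := by
  refine ⟨fun w hw => ?_, fun _ _ => rfl, fun _ => by simp, ?_, ?_⟩
  · rw [(hf v trivial).2.2.2 w hw]
  · intro w
    cases f w <;> simp [Blk.Feas]
  · intro A hA _
    obtain ⟨H, h1, h2⟩ := Blk.cyc (G := G) hn he (f v) (hf v trivial).2.2.1 A (hA v)
    exact ⟨H, h1, fun u hu i h hi _ => h2 u hu i h hi⟩

lemma ncard_bound {V : Type*} [Fintype V] {G : SimpleGraph V} [DecidableRel G.Adj]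
    (X : Set V) (u : V) (F : Finset V) (hF : ∀ w ∈ F, G.Adj u w) (hX : ∀ w ∈ X, G.Adj u w)
    (hd : ∀ w ∈ F, w ∉ X) : X.ncard + F.card ≤ G.maxDegree := by
  classical
  have h1 := G.degree_le_maxDegree u
  have : X.ncard + F.card ≤ G.degree u := by
    rw [← Set.ncard_coe_finset F, ← Set.ncard_union_eq (by
      rw [Set.disjoint_left]; intro w hw hw'; exact hd w hw' hw) (Set.toFinite _) (Set.toFinite _)]
    rw [← card_neighborFinset_eq_degree, ← Set.ncard_coe_finset]
    apply Set.ncard_le_ncard _ (Set.toFinite _)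
    rintro w (hw | hw)
    · simpa using hX w hw
    · simpa using hF w hw
  omega

lemma forbidden {V : Type*} [Fintype V] [DecidableEq V] {G : SimpleGraph V} [DecidableRel G.Adj]
    {n : ℕ} {f : V → Blk V} (hf : Tiling G Set.univ f) {S : Set V} {U : V → Finset ℕ}
    (hI : GInv G n f S U) {u v : V} (hu : u ∈ S) (hv : v ∉ S) (huv : G.Adj u v) :
    ∃ Fb : Finset ℕ, Fb.card + 3 ≤ 2 * G.maxDegree ∧ U u ⊆ Fb ∧
      ∀ i ∉ Fb, (i % 2 = 1 ∨ ¬ (f u).Cen u) →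
        (f u).Feas (fun w => if w = u then insert i (U u : Set ℕ) else (U w : Set ℕ)) := by
  obtain ⟨t1, -, t3, t4⟩ := hf u trivial
  have hcl := hI.closed u hu
  have hfeas := hI.feas u
  have hc := hI.card
  -- counting
  have key : ∀ x ∈ (f u).verts, ∀ F : Finset V, (∀ w ∈ F, G.Adj x w) →
      (∀ w ∈ F, w ∈ (f u).verts ∨ w ∉ S) → (U x).card + F.card ≤ G.maxDegree := by
    intro x hx F h1 h2
    have := hc x
    rw [t4 x hx] at this
    have h3 := ncard_bound {w | G.Adj x w ∧ w ∈ S ∧ w ∉ (f u).verts} x F h1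
      (fun w hw => hw.1) (by
        intro w hw hw'
        rcases h2 w hw with h | h
        · exact hw'.2.2 h
        · exact h hw'.2.1)
    omega
  have nuv : ∀ w ∈ (f u).verts, w ≠ v := by
    rintro w hw rfl; exact hv (hcl hw)
  generalize f u = B at *
  cases B with
  | two a b =>
    simp only [Blk.Valid] at t3
    refine ⟨U u, ?_, subset_rfl, fun _ _ _ => trivial⟩
    have ma : a ∈ (Blk.two a b).verts := Or.inl rfl
    have mb : b ∈ (Blk.two a b).verts := Or.inr rfl
    have : (U u).card + 2 ≤ G.maxDegree := by
      rcases t1 with rfl | rfl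
      · have := key u ma {b, v} (by simp [t3, huv]) (by simp [mb, hv])
        rwa [Finset.card_pair (nuv b mb)] at this
      · have := key u mb {a, v} (by simp [t3.symm, huv]) (by simp [ma, hv])
        rwa [Finset.card_pair (nuv a ma)] at this
    omega
  | three a b c =>
    obtain ⟨hab, hbc, hac⟩ := t3
    have ma : a ∈ (Blk.three a b c).verts := Or.inl rfl
    have mb : b ∈ (Blk.three a b c).verts := Or.inr (Or.inl rfl)
    have mc : c ∈ (Blk.three a b c).verts := Or.inr (Or.inr rfl)
    have nab := hab.ne
    have nbc := hbc.ne
    obtain ⟨f1, f2⟩ := hfeas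
    simp only [Finset.mem_coe] at f1 f2
    rcases t1 with rfl | rfl | rfl
    · have h1 := key u ma {b, v} (by simp [hab, huv]) (by simp [mb, hv])
      rw [Finset.card_pair (nuv b mb)] at h1
      have h2 := key c mc {b} (by simp [hbc.symm]) (by simp [mb])
      rw [Finset.card_singleton] at h2
      refine ⟨U u ∪ U c, ?_, Finset.subset_union_left, ?_⟩
      · have := Finset.card_union_le (U u) (U c); omega
      · intro i hi _
        simp only [Blk.Feas, if_neg nab.symm, if_neg hac.symm, if_true, Set.mem_insert_iff,
          Finset.mem_coe]
        grind
    · have h1 := key u mb {a, v} (by simp [hab.symm, huv]) (by simp [ma, hv])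
      rw [Finset.card_pair (nuv a ma)] at h1
      refine ⟨U u, by omega, subset_rfl, ?_⟩
      intro i hi hi'
      simp only [Blk.Cen] at hi'
      simp only [Blk.Feas, if_neg nab, if_neg nbc.symm, if_true, Set.mem_insert_iff,
          Finset.mem_coe]
      grind
    · have h1 := key u mc {b, v} (by simp [hbc.symm, huv]) (by simp [mb, hv])
      rw [Finset.card_pair (nuv b mb)] at h1
      have h2 := key a ma {b} (by simp [hab]) (by simp [mb])
      rw [Finset.card_singleton] at h2
      refine ⟨U u ∪ U a, ?_, Finset.subset_union_left, ?_⟩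
      · have := Finset.card_union_le (U u) (U a); omega
      · intro i hi _
        simp only [Blk.Feas, if_neg nbc, if_neg hac, if_true, Set.mem_insert_iff,
          Finset.mem_coe]
        grind

lemma pick (Fb : Finset ℕ) (m k : ℕ) (h : Fb.card < m) : ∃ j < m, 2 * j + k ∉ Fb := by
  by_contra! hc
  have : ((Finset.range m).image (fun j => 2 * j + k)) ⊆ Fb := by
    intro x hx
    simp only [Finset.mem_image, Finset.mem_range] at hx
    obtain ⟨j, hj, rfl⟩ := hx
    exact hc j hj
  have h2 := Finset.card_le_card this
  rw [Finset.card_image_of_injective _ (fun a b h => by simpa using h), Finset.card_range] at h2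
  omega

lemma inv_step {V : Type*} [Fintype V] [DecidableEq V] {G : SimpleGraph V} [DecidableRel G.Adj]
    {n : ℕ} (hn : 2 ≤ n) (he : Even n) (hD : 4 * G.maxDegree - 2 ≤ n)
    {f : V → Blk V} (hf : Tiling G Set.univ f) {S : Set V} {U : V → Finset ℕ}
    (hI : GInv G n f S U) {u v : V} (hu : u ∈ S) (hv : v ∉ S) (huv : G.Adj u v) :
    ∃ U', GInv G n f (S ∪ (f v).verts) U' := by
  obtain ⟨Fb, hFb, hUFb, hfe⟩ := forbidden hf hI hu hv huv
  have hex : ∃ i, i + 1 < n ∧ i ∉ Fb ∧ (i % 2 = 1 ∨ (¬ (f u).Cen u ∧ ¬ (f v).Cen v)) := by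
    have he' : n % 2 = 0 := Nat.even_iff.1 he
    by_cases hc : (¬ (f u).Cen u ∧ ¬ (f v).Cen v)
    · obtain ⟨j, hj, hj'⟩ := pick Fb (n / 2) 0 (by omega)
      exact ⟨2 * j + 0, by omega, hj', Or.inr hc⟩
    · obtain ⟨j, hj, hj'⟩ := pick Fb (n / 2 - 1) 1 (by omega)
      exact ⟨2 * j + 1, by omega, hj', Or.inl (by omega)⟩
  obtain ⟨i, hin, hiF, hip⟩ := hex
  have nuv : u ≠ v := huv.ne
  obtain ⟨v1, -, v3, v4⟩ := hf v trivial
  obtain ⟨u1, -, u3, u4⟩ := hf u trivial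
  have hdis : ∀ w ∈ (f v).verts, w ∉ S := by
    intro w hw hwS
    have := hI.closed w hwS
    rw [v4 w hw] at this
    exact hv (this v1)
  have hUv : ∀ w ∈ (f v).verts, U w = ∅ := fun w hw => hI.empty w (hdis w hw)
  have huv' : u ∉ (f v).verts := fun h => hdis u h hu
  have hvu' : v ∉ (f u).verts := fun h => hv (hI.closed u hu h)
  let U' : V → Finset ℕ := fun w => if w = u then insert i (U u) else if w = v then {i} else U w
  have hU'u : U' u = insert i (U u) := by simp [U']
  have hU'v : U' v = {i} := by simp [U', nuv.symm]
  have hU'w : ∀ w, w ≠ u → w ≠ v → U' w = U w := fun w h1 h2 => by simp [U', h1, h2]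
  have hsub : ∀ w, U w ⊆ U' w := by
    intro w
    by_cases h1 : w = u
    · subst h1; rw [hU'u]; exact Finset.subset_insert _ _
    · by_cases h2 : w = v
      · subst h2; rw [hUv w v1]; exact Finset.empty_subset _
      · rw [hU'w w h1 h2]
  refine ⟨U', ⟨?_, ?_, ?_, ?_, ?_⟩⟩
  · rintro w (hw | hw)
    · exact (hI.closed w hw).trans Set.subset_union_left
    · rw [v4 w hw]; exact Set.subset_union_right
  · intro w hw
    have h1 : w ≠ u := by rintro rfl; exact hw (Or.inl hu)
    have h2 : w ≠ v := by rintro rfl; exact hw (Or.inr v1)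
    rw [hU'w w h1 h2]
    exact hI.empty w fun h => hw (Or.inl h)
  · intro w
    by_cases h1 : w = u
    · subst h1
      rw [hU'u]
      refine (Finset.card_insert_le _ _).trans ?_
      have hlt : {x | G.Adj w x ∧ x ∈ S ∧ x ∉ (f w).verts}.ncard <
          {x | G.Adj w x ∧ x ∈ S ∪ (f v).verts ∧ x ∉ (f w).verts}.ncard := by
        apply Set.ncard_lt_ncard _ (Set.toFinite _)
        have hsub' : {x | G.Adj w x ∧ x ∈ S ∧ x ∉ (f w).verts} ⊆
          {x | G.Adj w x ∧ x ∈ S ∪ (f v).verts ∧ x ∉ (f w).verts} :=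
          fun x hx => ⟨hx.1, Or.inl hx.2.1, hx.2.2⟩
        rw [Set.ssubset_iff_of_subset hsub']
        exact ⟨v, ⟨huv, Or.inr v1, hvu'⟩, fun h => hv h.2.1⟩
      have := hI.card w
      omega
    · by_cases h2 : w = v
      · subst h2
        rw [hU'v, Finset.card_singleton, Nat.succ_le_iff, Set.ncard_pos (Set.toFinite _)]
        exact ⟨u, huv.symm, Or.inl hu, huv'⟩
      · rw [hU'w w h1 h2]
        refine (hI.card w).trans (Set.ncard_le_ncard ?_ (Set.toFinite _))
        exact fun x hx => ⟨hx.1, Or.inl hx.2.1, hx.2.2⟩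
  · intro w
    by_cases hwu : u ∈ (f w).verts
    · have e : f u = f w := (hf w trivial).2.2.2 u hwu
      rw [← e]
      refine Blk.feas_congr ?_ (hfe i hiF (hip.imp id And.left))
      intro x hx
      by_cases h1 : x = u
      · subst h1; simp [hU'u]
      · have h2 : x ≠ v := by rintro rfl; exact hvu' hx
        simp [h1, hU'w x h1 h2]
    · by_cases hwv : v ∈ (f w).verts
      · have e : f v = f w := (hf w trivial).2.2.2 v hwv
        rw [← e]
        have hz : ∀ x ∈ (f v).verts, x ≠ v → U' x = ∅ := by
          intro x hx hxv
          rw [hU'w x (by rintro rfl; exact huv' hx) hxv, hUv x hx]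
        generalize f v = B at *
        cases B with
        | two a b => trivial
        | three a b c =>
          have ma := hz a (Or.inl rfl)
          have mb := hz b (Or.inr (Or.inl rfl))
          have mc := hz c (Or.inr (Or.inr rfl))
          have := v3.2.2
          simp only [Blk.Cen] at hip
          simp only [Blk.Feas, Finset.mem_coe]
          grind
      · refine Blk.feas_congr ?_ (hI.feas w)
        intro x hx
        rw [hU'w x (by rintro rfl; exact hwu hx) (by rintro rfl; exact hwv hx)]
  · intro A hA hUA
    obtain ⟨H₁, c1, e1⟩ := hI.cyc A hA (fun w => (Finset.coe_subset.2 (hsub w)).trans (hUA w))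
    obtain ⟨H₂, c2, e2⟩ := Blk.cyc (G := G) hn he (f v) v3 A (hA v)
    have a1 := e1 u hu i hin (hUA u (by simp [hU'u])) (fun h => hiF (hUFb h))
    have a2 := e2 v v1 i hin (hUA v (by simp [hU'v]))
    obtain ⟨H, c, m1, m2⟩ := c1.merge c2 (by
      rw [Set.disjoint_left]; intro x hx hx'; exact hdis _ hx' hx) a1 a2
      (boxProd_adj_right.2 huv) (boxProd_adj_right.2 huv)
    refine ⟨H, ?_, ?_⟩
    · convert c using 1
      rfl
    · intro w hw j hj hjA hjU
      rcases hw with hw | hw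
      · refine m1 _ _ (e1 w hw j hj hjA fun h => hjU (hsub w h)) ?_
        intro hs
        have : w = u ∧ j = i := by
          simp only [Sym2.eq_iff, Prod.mk.injEq, Fin.mk.injEq] at hs
          grind
        obtain ⟨rfl, rfl⟩ := this
        exact hjU (by simp [hU'u])
      · refine m2 _ _ (e2 w hw j hj hjA) ?_
        intro hs
        have : w = v ∧ j = i := by
          simp only [Sym2.eq_iff, Prod.mk.injEq, Fin.mk.injEq] at hs
          grind
        obtain ⟨rfl, rfl⟩ := this
        exact hjU (by simp [hU'v])

lemma main_path {V : Type*} [Fintype V] [DecidableEq V] {G : SimpleGraph V} [DecidableRel G.Adj]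
    {n : ℕ} (hn : 2 ≤ n) (he : Even n) (hD : 4 * G.maxDegree - 2 ≤ n) (hG : G.Connected)
    {f : V → Blk V} (hf : Tiling G Set.univ f) :
    ∃ H, CycOn (pathGraph n □ G) H Set.univ := by
  obtain ⟨v₀⟩ := hG.nonempty
  obtain ⟨S, ⟨hS, U, hI⟩, hmax⟩ := (Set.toFinite
    {S : Set V | v₀ ∈ S ∧ ∃ U, GInv G n f S U}).exists_maximal
    ⟨(f v₀).verts, (hf v₀ trivial).1, _, inv_base hn he hf v₀⟩
  have hall : S = Set.univ := by
    by_contra hne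
    obtain ⟨w, hw⟩ := (Set.ne_univ_iff_exists_notMem S).1 hne
    obtain ⟨p⟩ := hG.preconnected v₀ w
    obtain ⟨d, -, hd1, hd2⟩ := p.exists_boundary_dart S hS hw
    obtain ⟨U', hI'⟩ := inv_step hn he hD hf hI hd1 hd2 d.adj
    have := hmax ⟨Or.inl hS, U', hI'⟩ Set.subset_union_left
    exact hd2 (this (Or.inr (hf d.snd trivial).1))
  subst hall
  obtain ⟨H, h, -⟩ := hI.cyc (fun u => (U u : Set ℕ)) hI.feas (fun _ => subset_rfl)
  exact ⟨H, by convert h using 1; ext; simp⟩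

lemma tiling_add {V : Type*} {G : SimpleGraph V} {S : Set V} {f : V → Blk V} (hf : Tiling G S f)
    (B : Blk V) (hB : B.Valid G) (hd : ∀ v ∈ B.verts, v ∉ S) :
    ∃ f', Tiling G (B.verts ∪ S) f' := by
  classical
  refine ⟨fun v => if v ∈ B.verts then B else f v, ?_⟩
  intro v hv
  by_cases h : v ∈ B.verts
  · simp only [h, if_true]
    exact ⟨trivial, Set.subset_union_left, hB, fun w hw => by simp [hw]⟩
  · have hS : v ∈ S := hv.resolve_left h
    obtain ⟨h1, h2, h3, h4⟩ := hf v hS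
    simp only [h, if_false]
    refine ⟨h1, h2.trans Set.subset_union_right, h3, fun w hw => ?_⟩
    have : w ∉ B.verts := fun hw' => hd w hw' (h2 hw)
    simp [this, h4 w hw]

lemma tiling_list {V : Type*} {G : SimpleGraph V} (k : ℕ) : ∀ l : List V, l.length ≤ k →
    l.Nodup → l.IsChain G.Adj → l.length ≠ 1 → ∃ f, Tiling G {v | v ∈ l} f := by
  induction k with
  | zero =>
    intro l hl _ _ _
    obtain rfl : l = [] := List.length_eq_zero_iff.1 (by omega)
    exact ⟨fun v => .two v v, by intro v hv; simp at hv⟩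
  | succ k ih =>
    intro l hl hnd hch h1
    match l, hl, hnd, hch, h1 with
    | [], _, _, _, _ => exact ⟨fun v => .two v v, by intro v hv; simp at hv⟩
    | [a], _, _, _, h1 => simp at h1
    | [a, b, c], _, hnd, hch, _ =>
      simp only [List.isChain_cons_cons, List.nodup_cons, List.mem_cons, List.not_mem_nil] at hnd hch
      obtain ⟨f, hf⟩ := tiling_add (G := G) (S := ∅) (f := fun v => .two v v)
        (fun v hv => hv.elim) (.three a b c) ⟨hch.1, hch.2.1, by grind⟩ (by simp)
      refine ⟨f, ?_⟩
      convert hf using 1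
      ext v; simp [Blk.verts]
    | a :: b :: l, hl, hnd, hch, _ =>
      by_cases hl1 : l.length = 1
      · obtain ⟨c, rfl⟩ := List.length_eq_one_iff.1 hl1
        simp only [List.isChain_cons_cons, List.nodup_cons, List.mem_cons, List.not_mem_nil] at hnd hch
        obtain ⟨f, hf⟩ := tiling_add (G := G) (S := ∅) (f := fun v => .two v v)
          (fun v hv => hv.elim) (.three a b c) ⟨hch.1, hch.2.1, by grind⟩ (by simp)
        refine ⟨f, ?_⟩
        convert hf using 1
        ext v; simp [Blk.verts]
      · have hch2 : l.IsChain G.Adj := by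
          have := hch.tail.tail
          simpa using this
        simp only [List.nodup_cons, List.mem_cons] at hnd
        obtain ⟨f, hf⟩ := ih l (by simp at hl; omega) hnd.2.2 hch2 hl1
        obtain ⟨f', hf'⟩ := tiling_add hf (.two a b) (List.isChain_cons_cons.1 hch).1 (by
          rintro v (rfl | rfl) <;> simp only [Set.mem_ofPred_eq] <;> grind)
        refine ⟨f', ?_⟩
        convert hf' using 1
        ext v; simp [Blk.verts, or_assoc]

lemma tiling_of_factor {V : Type*} {G : SimpleGraph V} (h : G.HasPathFactor) :
    ∃ f, Tiling G Set.univ f := by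
  obtain ⟨F, hF, hc⟩ := h
  have hm : ∀ v, v ∈ F.verts := fun v => by rw [hF]; trivial
  let C : V → F.coe.ConnectedComponent := fun v => F.coe.connectedComponentMk ⟨v, hm v⟩
  have key : ∀ c : F.coe.ConnectedComponent, ∃ f, Tiling G {v | C v = c} f := by
    intro c
    obtain ⟨k, hk, ⟨e⟩⟩ := hc c
    have hinj : Function.Injective (fun i : Fin k => ((e.symm i).1.1 : V)) := by
      intro i j hij
      exact e.symm.injective (Subtype.ext (Subtype.ext hij))
    obtain ⟨f, hf⟩ := tiling_list (G := G) k
      ((List.finRange k).map (fun i => ((e.symm i).1.1 : V))) (by simp)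
      ((List.nodup_finRange k).map hinj) (by
        rw [List.isChain_iff_getElem]
        intro i hi
        simp only [List.length_map, List.length_finRange] at hi
        simp only [List.getElem_map, List.getElem_finRange]
        have hadj : (pathGraph k).Adj ⟨i, by omega⟩ ⟨i + 1, hi⟩ := by
          rw [pathGraph_adj]; simp
        have := e.symm.map_rel_iff.2 hadj
        exact F.adj_sub this) (by simp; omega)
    refine ⟨f, ?_⟩
    convert hf using 1
    ext v
    simp only [Set.mem_ofPred_eq, List.mem_map, List.mem_finRange, true_and]
    constructor
    · intro hv
      exact ⟨e ⟨⟨v, hm v⟩, hv⟩, by simp⟩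
    · rintro ⟨i, rfl⟩
      exact (e.symm i).2
  choose f hf using key
  refine ⟨fun v => f (C v) v, fun v _ => ?_⟩
  obtain ⟨h1, h2, h3, h4⟩ := hf (C v) v rfl
  refine ⟨h1, Set.subset_univ _, h3, fun w hw => ?_⟩
  have : C w = C v := h2 hw
  simp only [this]
  exact h4 w hw

theorem stmt11 {V₁ V₂ : Type*} [Fintype V₁] [Fintype V₂] [DecidableEq V₁] [DecidableEq V₂]
    (G₁ : SimpleGraph V₁) (G₂ : SimpleGraph V₂) [DecidableRel G₂.Adj]
    (hG₁ : G₁.Traceable) (heven : Even (Fintype.card V₁))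
    (hconn : G₂.Connected) (hpf : G₂.HasPathFactor)
    (h : 4 * G₂.maxDegree - 2 ≤ Fintype.card V₁) :
    (G₁ □ G₂).IsHamiltonian := by
  obtain ⟨a, b, p, hp⟩ := hG₁
  obtain ⟨f, hf⟩ := tiling_of_factor hpf
  have hlen := hp.length_support
  rw [← hlen] at heven h
  have hpos : 0 < p.support.length := by simp
  have hn : 2 ≤ p.support.length := by
    have := Nat.even_iff.1 heven
    omega
  obtain ⟨H, hH⟩ := main_path hn heven h hconn hf
  have hne : Nonempty (Fin p.support.length × V₂) :=
    ⟨(⟨0, hpos⟩, hconn.nonempty.some)⟩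
  have hcard : Fintype.card (Fin p.support.length × V₂) ≠ 1 := by
    rw [Fintype.card_prod, Fintype.card_fin]
    intro h1
    have := Nat.eq_one_of_mul_eq_one_right h1
    omega
  obtain ⟨x, q, hq⟩ := hH.isHamiltonian hcard
  have hadj : ∀ i j : Fin p.support.length, (pathGraph p.support.length).Adj i j →
      G₁.Adj (hp.getVertEquiv i) (hp.getVertEquiv j) := by
    intro i j hij
    have hi := i.2
    have hj := j.2
    have hls := p.length_support
    simp only [Walk.IsHamiltonian.getVertEquiv_apply, Function.comp]
    rcases pathGraph_adj.1 hij with e | e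
    · rw [← e]; exact p.adj_getVert_succ (by omega)
    · rw [← e]; exact (p.adj_getVert_succ (by omega)).symm
  let φ : (pathGraph p.support.length □ G₂) →g (G₁ □ G₂) :=
    { toFun := fun x => (hp.getVertEquiv x.1, x.2)
      map_rel' := by
        intro x y hxy
        rw [boxProd_adj] at hxy ⊢
        rcases hxy with ⟨h1, h2⟩ | ⟨h1, h2⟩
        · exact Or.inl ⟨hadj _ _ h1, h2⟩
        · exact Or.inr ⟨h1, by rw [h2]⟩ }
  have hφ : Function.Bijective φ :=
    (Equiv.prodCongr hp.getVertEquiv (Equiv.refl V₂)).bijective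
  exact fun _ => ⟨_, q.map φ, hq.map hφ⟩
end

section
/- Let G2 be a connected graph with δ(G2) ≥ |V(G2)|/3 and G1 a traceable graph of even order with |V(G1)| ≥ 4Δ(G2) − 2. Then G1 □ G2 is Hamiltonian. -/
open SimpleGraph

/-- `H` has a cycle (a closed-up path) with vertex set `S` whose edges include `F`. -/
def CycOn_s13 {α : Type*} (H : SimpleGraph α) (S : Set α) (F : Set (Sym2 α)) : Prop :=
  ∃ (a b : α) (p : H.Walk a b), p.IsPath ∧ H.Adj b a ∧ (∀ v, v ∈ p.support ↔ v ∈ S) ∧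
    ∀ e ∈ F, e ∈ p.edges ∨ e = s(b, a)

lemma CycOn_s13.mono {α : Type*} {H : SimpleGraph α} {S : Set α} {F F' : Set (Sym2 α)}
    (h : CycOn_s13 H S F) (hF : F' ⊆ F) : CycOn_s13 H S F' := by
  obtain ⟨a, b, p, h1, h2, h3, h4⟩ := h
  exact ⟨a, b, p, h1, h2, h3, fun e he => h4 e (hF he)⟩

lemma walk_split_edge {α : Type*} {H : SimpleGraph α} {x x' : α} :
    ∀ {a b : α} (p : H.Walk a b), s(x, x') ∈ p.edges →
    (∃ (q : H.Walk a x) (h : H.Adj x x') (r : H.Walk x' b), p = q.append (Walk.cons h r)) ∨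
    (∃ (q : H.Walk a x') (h : H.Adj x' x) (r : H.Walk x b), p = q.append (Walk.cons h r)) := by
  intro a b p
  induction p with
  | nil => intro h; simp at h
  | @cons u v w h p ih =>
    intro he
    rw [Walk.edges_cons, List.mem_cons] at he
    rcases he with he | he
    · rw [Sym2.eq_iff] at he
      rcases he with ⟨rfl, rfl⟩ | ⟨rfl, rfl⟩
      · exact Or.inl ⟨Walk.nil, h, p, by simp⟩
      · exact Or.inr ⟨Walk.nil, h, p, by simp⟩
    · rcases ih he with ⟨q, h', r, rfl⟩ | ⟨q, h', r, rfl⟩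
      · exact Or.inl ⟨Walk.cons h q, h', r, by simp⟩
      · exact Or.inr ⟨Walk.cons h q, h', r, by simp⟩

/-- The re-rooting of a cycle at one of its edges. -/
lemma rotate_aux {α : Type*} {H : SimpleGraph α} {a b x x' : α}
    (q : H.Walk a x) (h : H.Adj x x') (r : H.Walk x' b) (hba : H.Adj b a)
    (hp : (q.append (Walk.cons h r)).IsPath) :
    (r.append (Walk.cons hba q)).IsPath ∧
    (∀ v, v ∈ (r.append (Walk.cons hba q)).support ↔ v ∈ (q.append (Walk.cons h r)).support) ∧
    ∀ e, (e ∈ (q.append (Walk.cons h r)).edges ∨ e = s(b, a)) →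
      e ∈ (r.append (Walk.cons hba q)).edges ∨ e = s(x, x') := by
  refine ⟨?_, ?_, ?_⟩
  · rw [Walk.isPath_def, Walk.support_append] at hp ⊢
    simp only [Walk.support_cons, List.tail_cons] at hp ⊢
    exact List.nodup_append_comm.mp hp
  · intro v
    simp only [Walk.support_append, Walk.support_cons, List.tail_cons, List.mem_append]
    tauto
  · intro e
    simp only [Walk.edges_append, Walk.edges_cons, List.mem_append, List.mem_cons]
    tauto

lemma CycOn_s13.open_at {α : Type*} {H : SimpleGraph α} {S : Set α} {F : Set (Sym2 α)}
    (hc : CycOn_s13 H S F) {x x' : α} (hx : s(x, x') ∈ F) :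
    ∃ p : H.Walk x x', p.IsPath ∧ (∀ v, v ∈ p.support ↔ v ∈ S) ∧
      ∀ e ∈ F, e ∈ p.edges ∨ e = s(x, x') := by
  obtain ⟨a, b, p, h1, h2, h3, h4⟩ := hc
  rcases h4 _ hx with he | he
  · rcases walk_split_edge p he with ⟨q, h, r, rfl⟩ | ⟨q, h, r, rfl⟩
    · obtain ⟨k1, k2, k3⟩ := rotate_aux q h r h2 h1
      refine ⟨(r.append (Walk.cons h2 q)).reverse, k1.reverse, ?_, ?_⟩
      · intro v
        rw [Walk.support_reverse, List.mem_reverse, k2, h3]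
      · intro e he'
        rw [Walk.edges_reverse, List.mem_reverse]
        exact k3 e (h4 e he')
    · obtain ⟨k1, k2, k3⟩ := rotate_aux q h r h2 h1
      refine ⟨(r.append (Walk.cons h2 q)), k1, ?_, ?_⟩
      · intro v
        rw [k2, h3]
      · intro e he'
        rw [Sym2.eq_swap]
        exact k3 e (h4 e he')
  · rw [Sym2.eq_iff] at he
    rcases he with ⟨rfl, rfl⟩ | ⟨rfl, rfl⟩
    · refine ⟨p.reverse, h1.reverse, ?_, ?_⟩
      · intro v
        rw [Walk.support_reverse, List.mem_reverse, h3]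
      · intro e he'
        rw [Walk.edges_reverse, List.mem_reverse]
        exact h4 e he'
    · exact ⟨p, h1, h3, fun e he' => by rw [Sym2.eq_swap]; exact h4 e he'⟩

lemma CycOn_s13.merge {α : Type*} {H : SimpleGraph α} {S₁ S₂ : Set α} {F₁ F₂ : Set (Sym2 α)}
    (h₁ : CycOn_s13 H S₁ F₁) (h₂ : CycOn_s13 H S₂ F₂) (hd : ∀ v, v ∈ S₁ → v ∈ S₂ → False)
    {x x' y y' : α} (hx : s(x, x') ∈ F₁) (hy : s(y, y') ∈ F₂)
    (a : H.Adj x y) (a' : H.Adj x' y') :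
    CycOn_s13 H (S₁ ∪ S₂) {e | (e ∈ F₁ ∧ e ≠ s(x, x')) ∨ (e ∈ F₂ ∧ e ≠ s(y, y')) ∨
      e = s(x, y) ∨ e = s(x', y')} := by
  rw [Sym2.eq_swap] at hx
  obtain ⟨p, p1, p2, p3⟩ := h₁.open_at hx
  obtain ⟨q, q1, q2, q3⟩ := h₂.open_at hy
  refine ⟨x', y', p.append (Walk.cons a q), ?_, a'.symm, ?_, ?_⟩
  · rw [Walk.isPath_def, Walk.support_append]
    simp only [Walk.support_cons, List.tail_cons]
    rw [List.nodup_append']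
    refine ⟨p1.support_nodup, q1.support_nodup, ?_⟩
    intro v hv hv'
    exact hd v ((p2 v).1 hv) ((q2 v).1 hv')
  · intro v
    simp only [Walk.support_append, Walk.support_cons, List.tail_cons, List.mem_append,
      Set.mem_union, p2, q2]
  · intro e he
    simp only [Walk.edges_append, Walk.edges_cons, List.mem_append, List.mem_cons]
    rcases he with ⟨he, hn⟩ | ⟨he, hn⟩ | rfl | rfl
    · rcases p3 e he with h | h
      · tauto
      · exact absurd (h.trans Sym2.eq_swap) hn
    · rcases q3 e he with h | h
      · tauto
      · exact absurd h hn
    · tauto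
    · right; exact Sym2.eq_swap

lemma CycOn_s13.isHamiltonian {α : Type*} [Fintype α] [DecidableEq α] {H : SimpleGraph α}
    {F : Set (Sym2 α)} (h : CycOn_s13 H Set.univ F) (hc : 3 ≤ Fintype.card α) : H.IsHamiltonian := by
  obtain ⟨a, b, p, h1, h2, h3, h4⟩ := h
  intro _
  have hp : p.IsHamiltonian := h1.isHamiltonian_of_mem (fun w => (h3 w).2 trivial)
  have hl := hp.length_eq
  refine ⟨b, Walk.cons h2 p, ?_⟩
  rw [Walk.isHamiltonianCycle_iff_isCycle_and_length_eq]
  refine ⟨?_, by rw [Walk.length_cons]; omega⟩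
  rw [Walk.cons_isCycle_iff]
  refine ⟨h1, fun he => ?_⟩
  have hlen : p.length = 1 := by
    rcases walk_split_edge p he with ⟨q, h, r, rfl⟩ | ⟨q, h, r, rfl⟩
    · have : b ∈ q.support := q.end_mem_support
      have hb : b ∈ (Walk.cons h r).support.tail := by simp
      rw [Walk.isPath_def, Walk.support_append, List.nodup_append'] at h1
      exact absurd hb (h1.2.2 this)
    · have hq := h1.of_append_left
      have hr := h1.of_append_right.of_cons
      rw [Walk.isPath_iff_nil, Walk.nil_iff_eq_nil] at hq hr
      subst hq hr
      simp
  omega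

lemma exists_max_matching {V : Type*} [Fintype V] [DecidableEq V] (G : SimpleGraph V) :
    ∃ σ : V → V, (∀ v, σ (σ v) = v) ∧ (∀ v, σ v = v ∨ G.Adj v (σ v)) ∧
      (∀ u u', σ u = u → σ u' = u' → ¬ G.Adj u u') ∧
      (∀ u u' x, σ u = u → σ u' = u' → u ≠ u' → G.Adj u x → G.Adj u' (σ x) → False) := by
  classical
  let P : Finset (V → V) :=
    Finset.univ.filter (fun σ => (∀ v, σ (σ v) = v) ∧ (∀ v, σ v = v ∨ G.Adj v (σ v)))
  have hP : P.Nonempty := ⟨id, by simp [P]⟩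
  obtain ⟨σ, hσ, hmin⟩ := P.exists_min_image
    (fun σ => (Finset.univ.filter (fun v => σ v = v)).card) hP
  simp only [P, Finset.mem_filter, Finset.mem_univ, true_and] at hσ hmin
  obtain ⟨h1, h2⟩ := hσ
  have key : ∀ τ : V → V, (∀ v, τ (τ v) = v) → (∀ v, τ v = v ∨ G.Adj v (τ v)) →
      (∀ v, τ v = v → σ v = v) → ∀ u, σ u = u → τ u ≠ u → False := by
    intro τ t1 t2 t3 u hu hu'
    have := hmin τ ⟨t1, t2⟩
    refine absurd this (not_le.mpr (Finset.card_lt_card ?_))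
    rw [Finset.ssubset_iff_of_subset]
    · exact ⟨u, by simp [hu], by simp [hu']⟩
    · intro v hv
      simp only [Finset.mem_filter, Finset.mem_univ, true_and] at hv ⊢
      exact t3 v hv
  have hA : ∀ u u', σ u = u → σ u' = u' → ¬ G.Adj u u' := by
    intro u u' hu hu' ha
    have hne := ha.ne
    refine key (fun v => if v = u then u' else if v = u' then u else σ v) ?_ ?_ ?_ u hu ?_
    · intro v; grind
    · intro v; have := h2 v; have := ha.symm; grind
    · intro v hv; grind
    · simp [hne.symm]
  refine ⟨σ, h1, h2, hA, ?_⟩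
  intro u u' x hu hu' hne hx hx'
  have hxx : σ x ≠ x := fun h => hA u x hu h hx
  have n1 : x ≠ u := hx.ne'
  have n2 : σ x ≠ u' := hx'.ne'
  have n3 : x ≠ u' := by rintro rfl; exact hxx hu'
  have n4 : σ x ≠ u := by intro h; have := h1 x; grind
  refine key (fun v => if v = u then x else if v = x then u else if v = u' then σ x else
    if v = σ x then u' else σ v) ?_ ?_ ?_ u hu ?_
  · intro v; have := h1 v; have := h1 x; grind
  · intro v; have := h2 v; have := hx.symm; have := hx'.symm; grind
  · intro v hv; grind
  · simp [n1]

lemma exists_blocks {V : Type*} [Fintype V] [DecidableEq V] (G : SimpleGraph V)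
    [DecidableRel G.Adj] (δ : ℕ) (hδ : ∀ v, δ ≤ G.degree v) (hn : Fintype.card V ≤ 3 * δ)
    (hpos : 0 < δ) :
    ∃ κ : V → Sym2 V, ∀ y,
      (∃ a b, G.Adj a b ∧ ∀ z, κ z = κ y ↔ z = a ∨ z = b) ∨
      (∃ a b c, G.Adj a b ∧ G.Adj b c ∧ a ≠ c ∧ ∀ z, κ z = κ y ↔ z = a ∨ z = b ∨ z = c) := by
  classical
  obtain ⟨σ, h1, h2, h3, h4⟩ := exists_max_matching G
  let T : {v : V // σ v = v} → Finset (Sym2 V) :=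
    fun u => (G.neighborFinset u).image (fun x => s(x, σ x))
  have hinj : Function.Injective σ := fun a b h => by rw [← h1 a, ← h1 b, h]
  have hall : ∀ X : Finset {v : V // σ v = v}, X.card ≤ (X.biUnion T).card := by
    intro X
    rcases Nat.lt_or_ge 1 X.card with hX | hX
    · obtain ⟨u, hu, u', hu', hne⟩ := Finset.one_lt_card.1 hX
      let E := X.biUnion T
      let A := G.neighborFinset u.1
      let B := (G.neighborFinset u'.1).image σ
      have hAB : Disjoint A B := by
        rw [Finset.disjoint_left]
        intro x hxA hxB
        simp only [A, B, mem_neighborFinset, Finset.mem_image] at hxA hxB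
        obtain ⟨w, hw, rfl⟩ := hxB
        exact h4 u u' (σ w) u.2 u'.2 (fun h => hne (Subtype.ext h)) hxA (by rw [h1]; exact hw)
      have hAc : δ ≤ A.card := by simpa [A] using hδ u
      have hBc : δ ≤ B.card := by
        rw [Finset.card_image_of_injective _ hinj]; simpa using hδ u'
      have hc := Finset.card_union_of_disjoint hAB
      have hmap : ∀ x ∈ A ∪ B, s(x, σ x) ∈ E := by
        intro x hx
        rw [Finset.mem_union] at hx
        simp only [E, Finset.mem_biUnion, T, Finset.mem_image]
        rcases hx with hx | hx
        · exact ⟨u, hu, x, hx, rfl⟩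
        · simp only [B, Finset.mem_image] at hx
          obtain ⟨w, hw, rfl⟩ := hx
          exact ⟨u', hu', w, hw, by rw [h1, Sym2.eq_swap]⟩
      have hE : (A ∪ B).card ≤ 2 * E.card := by
        refine Finset.card_le_mul_card_image_of_maps_to hmap 2 ?_
        intro e he
        induction e using Sym2.ind with
        | _ a b =>
          refine (Finset.card_le_card (t := {a, b}) ?_).trans Finset.card_le_two
          intro z hz
          simp only [Finset.mem_filter, Sym2.eq_iff] at hz
          simp only [Finset.mem_insert, Finset.mem_singleton]
          tauto
      have hmoved : Disjoint (A ∪ B) (Finset.univ.filter (fun v => σ v = v)) := by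
        rw [Finset.disjoint_left]
        intro x hx hx'
        simp only [A, B, Finset.mem_union, mem_neighborFinset, Finset.mem_image, Finset.mem_filter,
          Finset.mem_univ, true_and] at hx hx'
        rcases hx with hx | ⟨w, hw, rfl⟩
        · exact h3 _ _ u.2 hx' hx
        · exact h3 _ _ u'.2 (hinj hx') hw
      have hU : X.card ≤ (Finset.univ.filter (fun v => σ v = v)).card := by
        refine X.card_le_univ.trans ?_
        rw [Fintype.card_subtype]
      have htot := Finset.card_union_of_disjoint hmoved
      have := Finset.card_le_univ ((A ∪ B) ∪ (Finset.univ.filter (fun v => σ v = v)))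
      show X.card ≤ E.card
      omega
    · rcases X.eq_empty_or_nonempty with rfl | ⟨u, hu⟩
      · simp
      · refine hX.trans (Finset.card_pos.2 ?_)
        have : 0 < (G.neighborFinset u.1).card := by
          rw [card_neighborFinset_eq_degree]; exact hpos.trans_le (hδ u)
        obtain ⟨x, hx⟩ := Finset.card_pos.1 this
        exact ⟨s(x, σ x), by
          simp only [Finset.mem_biUnion, T, Finset.mem_image]; exact ⟨u, hu, x, hx, rfl⟩⟩
  obtain ⟨g, ginj, hg⟩ := (Finset.all_card_le_biUnion_card_iff_exists_injective T).1 hall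
  have hg' : ∀ u, ∃ x, G.Adj u.1 x ∧ s(x, σ x) = g u := by
    intro u
    simpa [T] using hg u
  let κ : V → Sym2 V := fun v => if h : σ v = v then g ⟨v, h⟩ else s(v, σ v)
  have κm : ∀ v, σ v ≠ v → κ v = s(v, σ v) := fun v h => by simp [κ, h]
  have κf : ∀ v (h : σ v = v), κ v = g ⟨v, h⟩ := fun v h => by simp [κ, h]
  have hrep : ∀ y, ∃ x, σ x ≠ x ∧ κ y = s(x, σ x) := by
    intro y
    by_cases hy : σ y = y
    · obtain ⟨x, hx, hx'⟩ := hg' ⟨y, hy⟩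
      exact ⟨x, fun h => h3 _ _ hy h hx, by rw [κf y hy, hx']⟩
    · exact ⟨y, hy, κm y hy⟩
  refine ⟨κ, fun y => ?_⟩
  obtain ⟨x, hx, hκ⟩ := hrep y
  rw [hκ]
  have hadj : G.Adj x (σ x) := (h2 x).resolve_left hx
  have hmv : ∀ z, σ z ≠ z → (κ z = s(x, σ x) ↔ z = x ∨ z = σ x) := by
    intro z hz
    rw [κm z hz, Sym2.eq_iff]
    constructor
    · tauto
    · rintro (rfl | rfl)
      · simp
      · simp [h1]
  have hx2 : σ (σ x) ≠ σ x := fun h => hx (hinj h)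
  by_cases hex : ∃ u, ∃ hu : σ u = u, g ⟨u, hu⟩ = s(x, σ x)
  · right
    obtain ⟨u, hu, hgu⟩ := hex
    have hux : u ≠ x := by rintro rfl; exact hx hu
    have hux' : u ≠ σ x := by rintro rfl; exact hx2 hu
    have hz : ∀ z, κ z = s(x, σ x) ↔ z = u ∨ z = x ∨ z = σ x := by
      intro z
      by_cases hz : σ z = z
      · rw [κf z hz, ← hgu, ginj.eq_iff]
        simp only [Subtype.mk.injEq]
        constructor
        · tauto
        · rintro (h | rfl | rfl)
          · exact h
          · exact absurd hz hx
          · exact absurd hz hx2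
      · rw [hmv z hz]
        constructor
        · tauto
        · rintro (rfl | h)
          · exact absurd hu hz
          · exact h
    obtain ⟨w, hw, hw'⟩ := hg' ⟨u, hu⟩
    rw [hgu, Sym2.eq_iff] at hw'
    rcases hw' with ⟨rfl, -⟩ | ⟨rfl, -⟩
    · exact ⟨u, w, σ w, hw, hadj, hux', hz⟩
    · exact ⟨u, σ x, x, hw, hadj.symm, hux, fun z => by rw [hz]; tauto⟩
  · left
    refine ⟨x, σ x, hadj, fun z => ?_⟩
    by_cases hz : σ z = z
    · constructor
      · intro h
        exact absurd ⟨z, hz, (κf z hz) ▸ h⟩ hex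
      · rintro (rfl | rfl)
        · exact absurd hz hx
        · exact absurd hz hx2
    · exact hmv z hz

/-- The vertices in rows `lo ≤ i < hi` over `D`. -/
def rowS {V₁ V₂ : Type*} (q : ℕ → V₁) (lo hi : ℕ) (D : Set V₂) : Set (V₁ × V₂) :=
  {p | ∃ i, lo ≤ i ∧ i < hi ∧ p.1 = q i ∧ p.2 ∈ D}

/-- The edge over `x` between rows `2j+1` and `2j+2`. -/
def vE {V₁ V₂ : Type*} (q : ℕ → V₁) (j : ℕ) (x : V₂) : Sym2 (V₁ × V₂) :=
  s((q (2 * j + 1), x), (q (2 * j + 2), x))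

/-- The edge in row `i` between `a` and `b`. -/
def hE {V₁ V₂ : Type*} (q : ℕ → V₁) (i : ℕ) (a b : V₂) : Sym2 (V₁ × V₂) :=
  s((q i, a), (q i, b))

section
variable {V₁ V₂ : Type*} {G₁ : SimpleGraph V₁} {G₂ : SimpleGraph V₂} {n : ℕ} {q : ℕ → V₁}

lemma block2 (hq : ∀ i, i + 1 < n → G₁.Adj (q i) (q (i + 1))) {a b : V₂} (hab : G₂.Adj a b)
    (k : ℕ) (hk : k + 1 < n) :
    CycOn_s13 (G₁ □ G₂) (rowS q k (k + 2) {z | z = a ∨ z = b})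
      {e | ∃ u v, (u = a ∧ v = b) ∧ (e = hE q k u v ∨ e = hE q (k + 1) u v)} := by
  have h := hq k hk
  have e1 : (G₁ □ G₂).Adj (q k, a) (q k, b) := by simp [boxProd_adj, hab]
  have e2 : (G₁ □ G₂).Adj (q k, b) (q (k + 1), b) := by simp [boxProd_adj, h]
  have e3 : (G₁ □ G₂).Adj (q (k + 1), b) (q (k + 1), a) := by simp [boxProd_adj, hab.symm]
  have e4 : (G₁ □ G₂).Adj (q (k + 1), a) (q k, a) := by simp [boxProd_adj, h.symm]
  refine ⟨_, _, Walk.cons e1 (Walk.cons e2 (Walk.cons e3 Walk.nil)), ?_, e4, ?_, ?_⟩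
  · have := h.ne
    have := h.ne'
    have := hab.ne
    have := hab.ne'
    simp [Walk.isPath_def, *]
  · rintro ⟨r, z⟩
    simp only [Walk.support_cons, Walk.support_nil, List.mem_cons, List.not_mem_nil, or_false,
      Prod.mk.injEq, rowS, Set.mem_ofPred_eq]
    constructor
    · rintro (⟨rfl, rfl⟩ | ⟨rfl, rfl⟩ | ⟨rfl, rfl⟩ | ⟨rfl, rfl⟩)
      · exact ⟨k, by omega, by omega, rfl, by tauto⟩
      · exact ⟨k, by omega, by omega, rfl, by tauto⟩
      · exact ⟨k + 1, by omega, by omega, rfl, by tauto⟩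
      · exact ⟨k + 1, by omega, by omega, rfl, by tauto⟩
    · rintro ⟨i, h1, h2, rfl, hz⟩
      obtain rfl | rfl : i = k ∨ i = k + 1 := by omega
      · tauto
      · tauto
  · rintro e ⟨u, v, ⟨rfl, rfl⟩, rfl | rfl⟩
    · simp [hE]
    · simp [hE]

lemma block3 (hq : ∀ i, i + 1 < n → G₁.Adj (q i) (q (i + 1))) {a b c : V₂} (hab : G₂.Adj a b)
    (hbc : G₂.Adj b c) (hac : a ≠ c) (k : ℕ) (hk : k + 1 < n) :
    CycOn_s13 (G₁ □ G₂) (rowS q k (k + 2) {z | z = a ∨ z = b ∨ z = c})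
      {e | ∃ u v, ((u = a ∧ v = b) ∨ (u = b ∧ v = c)) ∧
        (e = hE q k u v ∨ e = hE q (k + 1) u v)} := by
  have h := hq k hk
  have e1 : (G₁ □ G₂).Adj (q k, a) (q k, b) := by simp [boxProd_adj, hab]
  have e2 : (G₁ □ G₂).Adj (q k, b) (q k, c) := by simp [boxProd_adj, hbc]
  have e3 : (G₁ □ G₂).Adj (q k, c) (q (k + 1), c) := by simp [boxProd_adj, h]
  have e4 : (G₁ □ G₂).Adj (q (k + 1), c) (q (k + 1), b) := by simp [boxProd_adj, hbc.symm]
  have e5 : (G₁ □ G₂).Adj (q (k + 1), b) (q (k + 1), a) := by simp [boxProd_adj, hab.symm]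
  have e6 : (G₁ □ G₂).Adj (q (k + 1), a) (q k, a) := by simp [boxProd_adj, h.symm]
  refine ⟨_, _, Walk.cons e1 (Walk.cons e2 (Walk.cons e3 (Walk.cons e4 (Walk.cons e5 Walk.nil)))),
    ?_, e6, ?_, ?_⟩
  · have := h.ne
    have := h.ne'
    have := hab.ne
    have := hab.ne'
    have := hbc.ne
    have := hbc.ne'
    have := hac.symm
    simp [Walk.isPath_def, *]
  · rintro ⟨r, z⟩
    simp only [Walk.support_cons, Walk.support_nil, List.mem_cons, List.not_mem_nil, or_false,
      Prod.mk.injEq, rowS, Set.mem_ofPred_eq]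
    constructor
    · rintro (⟨rfl, rfl⟩ | ⟨rfl, rfl⟩ | ⟨rfl, rfl⟩ | ⟨rfl, rfl⟩ | ⟨rfl, rfl⟩ | ⟨rfl, rfl⟩)
      · exact ⟨k, by omega, by omega, rfl, by tauto⟩
      · exact ⟨k, by omega, by omega, rfl, by tauto⟩
      · exact ⟨k, by omega, by omega, rfl, by tauto⟩
      · exact ⟨k + 1, by omega, by omega, rfl, by tauto⟩
      · exact ⟨k + 1, by omega, by omega, rfl, by tauto⟩
      · exact ⟨k + 1, by omega, by omega, rfl, by tauto⟩
    · rintro ⟨i, h1, h2, rfl, hz⟩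
      obtain rfl | rfl : i = k ∨ i = k + 1 := by omega
      · tauto
      · tauto
  · rintro e ⟨u, v, ⟨rfl, rfl⟩ | ⟨rfl, rfl⟩, rfl | rfl⟩ <;> simp [hE]

lemma column (hq : ∀ i, i + 1 < n → G₁.Adj (q i) (q (i + 1)))
    (hinj : ∀ i j, i < n → j < n → q i = q j → i = j)
    (D : Set V₂) (FD : V₂ → V₂ → Prop)
    (hB : ∀ k, k + 1 < n → CycOn_s13 (G₁ □ G₂) (rowS q k (k + 2) D)
      {e | ∃ u v, FD u v ∧ (e = hE q k u v ∨ e = hE q (k + 1) u v)})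
    (c c' : ℕ → V₂) (hc : ∀ j, FD (c j) (c' j)) (m : ℕ) (hm : 2 * m + 1 < n) :
    CycOn_s13 (G₁ □ G₂) (rowS q 0 (2 * m + 2) D)
      {e | (∃ u v, FD u v ∧ e = hE q (2 * m + 1) u v) ∨
        ∃ j < m, e = vE q j (c j) ∨ e = vE q j (c' j)} := by
  induction m with
  | zero =>
    refine (hB 0 hm).mono ?_
    rintro e (⟨u, v, h, rfl⟩ | ⟨j, hj, -⟩)
    · exact ⟨u, v, h, by simp⟩
    · omega
  | succ m ih =>
    have h1 := ih (by omega)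
    have h2 := hB (2 * m + 2) (by omega)
    have hadj := hq (2 * m + 1) (by omega)
    have h3 := h1.merge h2 (x := (q (2 * m + 1), c m)) (x' := (q (2 * m + 1), c' m))
      (y := (q (2 * m + 2), c m)) (y' := (q (2 * m + 2), c' m)) ?_
      (Or.inl ⟨c m, c' m, hc m, rfl⟩) ⟨c m, c' m, hc m, Or.inl rfl⟩
      (by simpa [boxProd_adj] using hadj) (by simpa [boxProd_adj] using hadj)
    · have hS : rowS q 0 (2 * m + 2) D ∪ rowS q (2 * m + 2) (2 * m + 2 + 2) D =
          rowS q 0 (2 * (m + 1) + 2) D := by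
        ext p
        simp only [rowS, Set.mem_union, Set.mem_ofPred_eq]
        constructor
        · rintro (⟨i, a1, a2, a3⟩ | ⟨i, a1, a2, a3⟩)
          · exact ⟨i, by omega, by omega, a3⟩
          · exact ⟨i, by omega, by omega, a3⟩
        · rintro ⟨i, a1, a2, a3⟩
          rcases Nat.lt_or_ge i (2 * m + 2) with h | h
          · exact Or.inl ⟨i, by omega, by omega, a3⟩
          · exact Or.inr ⟨i, by omega, by omega, a3⟩
      rw [hS] at h3
      refine h3.mono ?_
      have hv : ∀ (j : ℕ) (x y z : V₂) (i : ℕ), j < m → vE q j x ≠ hE q i y z := by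
        intro j x y z i hj h
        have : q (2 * j + 1) = q (2 * j + 2) := by
          simp only [vE, hE, Sym2.eq_iff, Prod.mk.injEq] at h
          rcases h with ⟨⟨h, -⟩, h', -⟩ | ⟨⟨h, -⟩, h', -⟩ <;> rw [h, h']
        have := hinj _ _ (by omega) (by omega) this
        omega
      rintro e (⟨u, v, h, rfl⟩ | ⟨j, hj, he⟩)
      · right; left
        refine ⟨⟨u, v, h, Or.inr rfl⟩, ?_⟩
        intro he
        simp only [hE, Sym2.eq_iff, Prod.mk.injEq] at he
        have : q (2 * (m + 1) + 1) = q (2 * m + 2) := by tauto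
        have := hinj _ _ (by omega) (by omega) this
        omega
      · rcases Nat.lt_or_ge j m with hj' | hj'
        · left
          refine ⟨Or.inr ⟨j, hj', he⟩, ?_⟩
          rcases he with rfl | rfl
          · exact hv _ _ _ _ _ hj'
          · exact hv _ _ _ _ _ hj'
        · obtain rfl : j = m := by omega
          right; right
          exact he
    · rintro v ⟨i, a1, a2, a3, -⟩ ⟨i', b1, b2, b3, -⟩
      have := hinj i i' (by omega) (by omega) (a3.symm.trans b3)
      omega

/-- Cycle over one block with prescribed supply of vertical edges. -/
def ColCyc (G₁ : SimpleGraph V₁) (G₂ : SimpleGraph V₂) (q : ℕ → V₁) (M d : ℕ) (D : Set V₂)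
    (y : V₂) (j₀ : ℕ) : Prop :=
  ∃ A : V₂ → Finset ℕ, (∀ x, A x ⊆ Finset.range M) ∧
    CycOn_s13 (G₁ □ G₂) (rowS q 0 (2 * M + 2) D) {e | ∃ x ∈ D, ∃ j ∈ A x, e = vE q j x} ∧
    (j₀ < M → j₀ ∈ A y) ∧ ∀ x ∈ D, d ≤ (A x).card

lemma col2 {M d : ℕ} (hq : ∀ i, i + 1 < 2 * M + 2 → G₁.Adj (q i) (q (i + 1)))
    (hinj : ∀ i j, i < 2 * M + 2 → j < 2 * M + 2 → q i = q j → i = j)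
    {a b : V₂} (hab : G₂.Adj a b) (hd : 2 * d ≤ M) (y : V₂) (j₀ : ℕ) :
    ColCyc G₁ G₂ q M d {z | z = a ∨ z = b} y j₀ := by
  refine ⟨fun _ => Finset.range M, fun _ => subset_rfl, ?_, by simp, ?_⟩
  · refine (column hq hinj {z | z = a ∨ z = b} (fun u v => u = a ∧ v = b) (block2 hq hab)
      (fun _ => a) (fun _ => b) (fun _ => ⟨rfl, rfl⟩) M (by omega)).mono ?_
    rintro e ⟨x, rfl | rfl, j, hj, rfl⟩
    · exact Or.inr ⟨j, by simpa using hj, Or.inl rfl⟩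
    · exact Or.inr ⟨j, by simpa using hj, Or.inr rfl⟩
  · intro x _
    rw [Finset.card_range]
    omega

lemma col3 {M d : ℕ} (hq : ∀ i, i + 1 < 2 * M + 2 → G₁.Adj (q i) (q (i + 1)))
    (hinj : ∀ i j, i < 2 * M + 2 → j < 2 * M + 2 → q i = q j → i = j)
    {a b c : V₂} (hab : G₂.Adj a b) (hbc : G₂.Adj b c) (hac : a ≠ c) (hd : 2 * d ≤ M)
    (hd1 : 1 ≤ d) (y : V₂) (hy : y = a ∨ y = b) (j₀ : ℕ) :
    ColCyc G₁ G₂ q M d {z | z = a ∨ z = b ∨ z = c} y j₀ := by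
  classical
  obtain ⟨S, hS1, hS2, hS3⟩ := Finset.exists_subsuperset_card_eq
    (s := (Finset.range M).filter (· = j₀)) (t := Finset.range M) (n := d)
    (Finset.filter_subset _ _)
    (by
      refine le_trans (Finset.card_le_one.2 ?_) hd1
      intro i hi j hj
      rw [Finset.mem_filter] at hi hj
      rw [hi.2, hj.2]) (by rw [Finset.card_range]; omega)
  refine ⟨fun x => if x = a then S else if x = b then Finset.range M else Finset.range M \ S,
    ?_, ?_, ?_, ?_⟩
  · intro x
    dsimp only
    split_ifs
    · exact hS2
    · exact subset_rfl
    · exact Finset.sdiff_subset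
  · refine (column hq hinj {z | z = a ∨ z = b ∨ z = c}
      (fun u v => (u = a ∧ v = b) ∨ (u = b ∧ v = c)) (block3 hq hab hbc hac)
      (fun j => if j ∈ S then a else b) (fun j => if j ∈ S then b else c) ?_ M (by omega)).mono ?_
    · intro j
      by_cases hj : j ∈ S <;> simp [hj]
    · rintro e ⟨x, hx, j, hj, rfl⟩
      right
      have h1 := hab.ne
      have h2 := hbc.ne
      dsimp only at hj ⊢
      rcases hx with rfl | rfl | rfl
      · rw [if_pos rfl] at hj
        exact ⟨j, by simpa using hS2 hj, by simp [hj]⟩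
      · rw [if_neg h1.symm, if_pos rfl] at hj
        refine ⟨j, by simpa using hj, ?_⟩
        by_cases hj : j ∈ S <;> simp [hj]
      · rw [if_neg hac.symm, if_neg h2.symm, Finset.mem_sdiff] at hj
        exact ⟨j, by simpa using hj.1, by simp [hj.2]⟩
  · intro hj
    have : j₀ ∈ S := hS1 (by simp [hj])
    rcases hy with rfl | rfl
    · simpa using this
    · simp [hab.ne', hj]
  · intro x _
    dsimp only
    split_ifs
    · omega
    · rw [Finset.card_range]; omega
    · rw [Finset.card_sdiff_of_subset hS2, Finset.card_range]; omega

lemma col {M d : ℕ} (hq : ∀ i, i + 1 < 2 * M + 2 → G₁.Adj (q i) (q (i + 1)))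
    (hinj : ∀ i j, i < 2 * M + 2 → j < 2 * M + 2 → q i = q j → i = j)
    (D : Set V₂) (hd : 2 * d ≤ M)
    (hD : (∃ a b, G₂.Adj a b ∧ ∀ z, z ∈ D ↔ z = a ∨ z = b) ∨
      (∃ a b c, G₂.Adj a b ∧ G₂.Adj b c ∧ a ≠ c ∧ ∀ z, z ∈ D ↔ z = a ∨ z = b ∨ z = c))
    (hd1 : ∀ a b c, G₂.Adj a b → G₂.Adj b c → a ≠ c → 1 ≤ d)
    (y : V₂) (hy : y ∈ D) (j₀ : ℕ) : ColCyc G₁ G₂ q M d D y j₀ := by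
  rcases hD with ⟨a, b, hab, hD⟩ | ⟨a, b, c, hab, hbc, hac, hD⟩
  · have : D = {z | z = a ∨ z = b} := Set.ext hD
    rw [this]
    exact col2 hq hinj hab hd y j₀
  · have h1 := hd1 a b c hab hbc hac
    have h := (hD y).1 hy
    by_cases hya : y = a ∨ y = b
    · have : D = {z | z = a ∨ z = b ∨ z = c} := Set.ext hD
      rw [this]
      exact col3 hq hinj hab hbc hac hd h1 y hya j₀
    · have : D = {z | z = c ∨ z = b ∨ z = a} := Set.ext fun z => by
        rw [hD]; simp only [Set.mem_ofPred_eq]; tauto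
      rw [this]
      exact col3 hq hinj hbc.symm hab.symm hac.symm hd h1 y (by tauto) j₀

end

section
variable {V₁ V₂ : Type*} [Fintype V₂] [DecidableEq V₂]

/-- State of the construction: a cycle over `W`, a union of blocks, with enough spare edges. -/
def Stage (G₁ : SimpleGraph V₁) (G₂ : SimpleGraph V₂) [DecidableRel G₂.Adj] (q : ℕ → V₁) (M : ℕ)
    (κ : V₂ → Sym2 V₂) (W : Finset V₂) : Prop :=
  (∀ x ∈ W, ∀ z, κ z = κ x → z ∈ W) ∧
  ∃ A : V₂ → Finset ℕ, (∀ x, A x ⊆ Finset.range M) ∧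
    CycOn_s13 (G₁ □ G₂) (rowS q 0 (2 * M + 2) (W : Set V₂)) {e | ∃ x ∈ W, ∃ j ∈ A x, e = vE q j x} ∧
    ∀ x ∈ W, (G₂.neighborFinset x \ W).card ≤ (A x).card

variable {G₁ : SimpleGraph V₁} {G₂ : SimpleGraph V₂} [DecidableRel G₂.Adj] {q : ℕ → V₁} {M : ℕ}
  {κ : V₂ → Sym2 V₂}

lemma block_nbr {y : V₂}
    (hD : (∃ a b, G₂.Adj a b ∧ ∀ z, κ z = κ y ↔ z = a ∨ z = b) ∨
      (∃ a b c, G₂.Adj a b ∧ G₂.Adj b c ∧ a ≠ c ∧ ∀ z, κ z = κ y ↔ z = a ∨ z = b ∨ z = c))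
    (x : V₂) (hx : κ x = κ y) : ∃ w, G₂.Adj x w ∧ κ w = κ y := by
  rcases hD with ⟨a, b, hab, hD⟩ | ⟨a, b, c, hab, hbc, hac, hD⟩
  · rcases (hD x).1 hx with rfl | rfl
    · exact ⟨b, hab, (hD b).2 (by tauto)⟩
    · exact ⟨a, hab.symm, (hD a).2 (by tauto)⟩
  · rcases (hD x).1 hx with rfl | rfl | rfl
    · exact ⟨b, hab, (hD b).2 (by tauto)⟩
    · exact ⟨a, hab.symm, (hD a).2 (by tauto)⟩
    · exact ⟨b, hbc.symm, (hD b).2 (by tauto)⟩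

lemma stage_init {d : ℕ} (hdeg : ∀ x, G₂.degree x ≤ d + 1) {y : V₂}
    (hD : (∃ a b, G₂.Adj a b ∧ ∀ z, κ z = κ y ↔ z = a ∨ z = b) ∨
      (∃ a b c, G₂.Adj a b ∧ G₂.Adj b c ∧ a ≠ c ∧ ∀ z, κ z = κ y ↔ z = a ∨ z = b ∨ z = c))
    (hC : ColCyc G₁ G₂ q M d {z | κ z = κ y} y 0) :
    ∃ W : Finset V₂, W.Nonempty ∧ Stage G₁ G₂ q M κ W := by
  classical
  obtain ⟨A, hA, hc, -, hAd⟩ := hC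
  refine ⟨Finset.univ.filter (fun z => κ z = κ y), ⟨y, by simp⟩, ?_, A, hA, ?_, ?_⟩
  · intro x hx z hz
    simp only [Finset.mem_filter, Finset.mem_univ, true_and] at hx ⊢
    rw [hz, hx]
  · simpa using hc
  · intro x hx
    simp only [Finset.mem_filter, Finset.mem_univ, true_and] at hx
    refine le_trans ?_ (hAd x hx)
    obtain ⟨w, hw, hw'⟩ := block_nbr hD x hx
    have h1 : G₂.neighborFinset x \ Finset.univ.filter (fun z => κ z = κ y) ⊆
        (G₂.neighborFinset x).erase w := by
      intro z hz
      simp only [Finset.mem_sdiff, Finset.mem_filter, Finset.mem_univ, true_and] at hz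
      rw [Finset.mem_erase]
      exact ⟨fun h => hz.2 (h ▸ hw'), hz.1⟩
    have h2 := Finset.card_le_card h1
    rw [Finset.card_erase_of_mem (by simpa using hw), card_neighborFinset_eq_degree] at h2
    have := hdeg x
    omega

lemma vE_ne (hinj : ∀ i j, i < 2 * M + 2 → j < 2 * M + 2 → q i = q j → i = j) {i j : ℕ} {x z : V₂}
    (hi : i < M) (hj : j < M) (h : i ≠ j ∨ x ≠ z) : vE q i x ≠ vE q j z := by
  intro he
  simp only [vE, Sym2.eq_iff, Prod.mk.injEq] at he
  rcases he with ⟨⟨h1, h2⟩, -⟩ | ⟨⟨h1, h2⟩, -⟩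
  · have := hinj _ _ (by omega) (by omega) h1
    rcases h with h | h
    · omega
    · exact h h2
  · have := hinj _ _ (by omega) (by omega) h1
    omega

lemma stage_step {d : ℕ} (hdeg : ∀ x, G₂.degree x ≤ d + 1)
    (hinj : ∀ i j, i < 2 * M + 2 → j < 2 * M + 2 → q i = q j → i = j)
    {W : Finset V₂} (hW : Stage G₁ G₂ q M κ W) {x y : V₂} (hx : x ∈ W) (hy : y ∉ W)
    (hxy : G₂.Adj x y)
    (hD : (∃ a b, G₂.Adj a b ∧ ∀ z, κ z = κ y ↔ z = a ∨ z = b) ∨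
      (∃ a b c, G₂.Adj a b ∧ G₂.Adj b c ∧ a ≠ c ∧ ∀ z, κ z = κ y ↔ z = a ∨ z = b ∨ z = c))
    (hC : ∀ j₀, ColCyc G₁ G₂ q M d {z | κ z = κ y} y j₀) :
    ∃ W' : Finset V₂, W.card < W'.card ∧ Stage G₁ G₂ q M κ W' := by
  classical
  obtain ⟨hcl, A, hA, hc, hAd⟩ := hW
  have hpos : 0 < (A x).card := by
    refine lt_of_lt_of_le (Finset.card_pos.2 ⟨y, ?_⟩) (hAd x hx)
    simp [hxy, hy]
  obtain ⟨j, hj⟩ := Finset.card_pos.1 hpos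
  have hjM : j < M := by simpa using hA x hj
  obtain ⟨B, hB, hc', hBy, hBd⟩ := hC j
  have hBj := hBy hjM
  set D : Finset V₂ := Finset.univ.filter (fun z => κ z = κ y) with hDdef
  have memD : ∀ z, z ∈ D ↔ κ z = κ y := fun z => by simp [D]
  have hdisj : ∀ z, z ∈ W → z ∈ D → False := by
    intro z hz hz'
    exact hy (hcl z hz y ((memD z).1 hz').symm)
  have hyD : y ∈ D := by simp [D]
  have hDcoe : ({z | κ z = κ y} : Set V₂) = (D : Set V₂) := by ext z; simp [D]
  rw [hDcoe] at hc'
  have hm := hc.merge hc' (x := (q (2 * j + 1), x)) (x' := (q (2 * j + 2), x))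
    (y := (q (2 * j + 1), y)) (y' := (q (2 * j + 2), y))
    (by
      rintro ⟨r, z⟩ ⟨i, -, -, -, hz⟩ ⟨i', -, -, -, hz'⟩
      exact hdisj z (by simpa using hz) (by simpa using hz'))
    ⟨x, hx, j, hj, rfl⟩ ⟨y, by simpa using hyD, j, hBj, rfl⟩
    (by simpa [boxProd_adj] using hxy) (by simpa [boxProd_adj] using hxy)
  have hS : rowS q 0 (2 * M + 2) (W : Set V₂) ∪ rowS q 0 (2 * M + 2) (D : Set V₂) =
      rowS q 0 (2 * M + 2) ((W ∪ D : Finset V₂) : Set V₂) := by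
    ext p
    simp only [rowS, Set.mem_union, Set.mem_ofPred_eq, Finset.coe_union]
    constructor
    · rintro (⟨i, a1, a2, a3, a4⟩ | ⟨i, a1, a2, a3, a4⟩)
      · exact ⟨i, a1, a2, a3, Or.inl a4⟩
      · exact ⟨i, a1, a2, a3, Or.inr a4⟩
    · rintro ⟨i, a1, a2, a3, a4 | a4⟩
      · exact Or.inl ⟨i, a1, a2, a3, a4⟩
      · exact Or.inr ⟨i, a1, a2, a3, a4⟩
  rw [hS] at hm
  have hsd : ∀ z, G₂.neighborFinset z \ (W ∪ D) ⊆ G₂.neighborFinset z \ W := by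
    intro z
    exact Finset.sdiff_subset_sdiff subset_rfl Finset.subset_union_left
  refine ⟨W ∪ D, ?_, ?_, fun z => if z ∈ W then (if z = x then (A z).erase j else A z) else
    (if z = y then (B z).erase j else B z), ?_, ?_, ?_⟩
  · refine Finset.card_lt_card ?_
    rw [Finset.ssubset_iff_of_subset Finset.subset_union_left]
    exact ⟨y, Finset.mem_union_right _ hyD, hy⟩
  · intro z hz w hw
    rw [Finset.mem_union] at hz ⊢
    rcases hz with hz | hz
    · exact Or.inl (hcl z hz w hw)
    · exact Or.inr ((memD w).2 (hw.trans ((memD z).1 hz)))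
  · intro z
    dsimp only
    split_ifs
    · exact (Finset.erase_subset _ _).trans (hA z)
    · exact hA z
    · exact (Finset.erase_subset _ _).trans (hB z)
    · exact hB z
  · refine hm.mono ?_
    rintro e ⟨z, hz, i, hi, rfl⟩
    dsimp only at hi
    by_cases hzW : z ∈ W
    · rw [if_pos hzW] at hi
      left
      have hi' : i ∈ A z ∧ (i ≠ j ∨ z ≠ x) := by
        split_ifs at hi with h
        · rw [Finset.mem_erase] at hi
          exact ⟨hi.2, Or.inl hi.1⟩
        · exact ⟨hi, Or.inr h⟩
      exact ⟨⟨z, hzW, i, hi'.1, rfl⟩, vE_ne hinj (by simpa using hA z hi'.1) hjM hi'.2⟩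
    · rw [if_neg hzW] at hi
      right; left
      have hzD : z ∈ D := (Finset.mem_union.1 hz).resolve_left hzW
      have hi' : i ∈ B z ∧ (i ≠ j ∨ z ≠ y) := by
        split_ifs at hi with h
        · rw [Finset.mem_erase] at hi
          exact ⟨hi.2, Or.inl hi.1⟩
        · exact ⟨hi, Or.inr h⟩
      exact ⟨⟨z, by simpa using hzD, i, hi'.1, rfl⟩,
        vE_ne hinj (by simpa using hB z hi'.1) hjM hi'.2⟩
  · intro z hz
    by_cases hzW : z ∈ W
    · simp only [if_pos hzW]
      split_ifs with h
      · subst h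
        rw [Finset.card_erase_of_mem hj]
        have h1 : G₂.neighborFinset z \ (W ∪ D) ⊆ (G₂.neighborFinset z \ W).erase y := by
          intro w hw
          rw [Finset.mem_erase]
          refine ⟨?_, hsd z hw⟩
          rintro rfl
          rw [Finset.mem_sdiff, Finset.mem_union] at hw
          exact hw.2 (Or.inr hyD)
        have h2 := Finset.card_le_card h1
        rw [Finset.card_erase_of_mem (by simp [hxy, hy])] at h2
        have := hAd z hx
        omega
      · exact (Finset.card_le_card (hsd z)).trans (hAd z hzW)
    · simp only [if_neg hzW]
      have hzD : z ∈ D := (Finset.mem_union.1 hz).resolve_left hzW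
      have hBz := hBd z ((memD z).1 hzD)
      obtain ⟨w, hw, hw'⟩ := block_nbr hD z ((memD z).1 hzD)
      have hwD : w ∈ D := (memD w).2 hw'
      have hdz := hdeg z
      have h1 : G₂.neighborFinset z \ (W ∪ D) ⊆ (G₂.neighborFinset z).erase w := by
        intro t ht
        simp only [Finset.mem_sdiff, Finset.mem_union] at ht
        rw [Finset.mem_erase]
        exact ⟨fun h => ht.2 (Or.inr (h ▸ hwD)), ht.1⟩
      have hcz : ((G₂.neighborFinset z).erase w).card ≤ d := by
        rw [Finset.card_erase_of_mem (by simpa using hw), card_neighborFinset_eq_degree]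
        omega
      split_ifs with h
      · subst h
        rw [Finset.card_erase_of_mem hBj]
        have h3 : G₂.neighborFinset z \ (W ∪ D) ⊆ ((G₂.neighborFinset z).erase w).erase x := by
          intro t ht
          rw [Finset.mem_erase]
          refine ⟨?_, h1 ht⟩
          rintro rfl
          rw [Finset.mem_sdiff, Finset.mem_union] at ht
          exact ht.2 (Or.inl hx)
        have h4 := Finset.card_le_card h3
        rw [Finset.card_erase_of_mem (a := x)] at h4
        · omega
        · rw [Finset.mem_erase]
          exact ⟨fun h => hdisj x hx (h ▸ hwD), by simpa using hxy.symm⟩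
      · exact (Finset.card_le_card h1).trans (hcz.trans hBz)

end

theorem stmt13 {V₁ V₂ : Type*} [Fintype V₁] [Fintype V₂] [DecidableEq V₁] [DecidableEq V₂]
    (G₁ : SimpleGraph V₁) (G₂ : SimpleGraph V₂) [DecidableRel G₂.Adj]
    (hconn : G₂.Connected) (hdeg : Fintype.card V₂ ≤ 3 * G₂.minDegree)
    (hG₁ : G₁.Traceable) (heven : Even (Fintype.card V₁))
    (h : 4 * G₂.maxDegree - 2 ≤ Fintype.card V₁) :
    (G₁ □ G₂).IsHamiltonian := by
  classical
  obtain ⟨a, b, p, hp⟩ := hG₁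
  obtain ⟨v₀⟩ := hconn.nonempty
  have hV₂ : 0 < Fintype.card V₂ := Fintype.card_pos_iff.2 ⟨v₀⟩
  have hV₁ : 0 < Fintype.card V₁ := Fintype.card_pos_iff.2 ⟨a⟩
  have hmin : 0 < G₂.minDegree := by omega
  have hmm : G₂.minDegree ≤ G₂.maxDegree :=
    (G₂.minDegree_le_degree v₀).trans (G₂.degree_le_maxDegree v₀)
  have hdm : ∀ x, G₂.degree x ≤ G₂.maxDegree := G₂.degree_le_maxDegree
  have hlt : G₂.degree v₀ < Fintype.card V₂ := G₂.degree_lt_card_verts v₀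
  have hd0 := G₂.minDegree_le_degree v₀
  obtain ⟨d, hd⟩ : ∃ d, G₂.maxDegree = d + 1 := ⟨G₂.maxDegree - 1, by omega⟩
  obtain ⟨m, hm⟩ := heven
  obtain ⟨M, hM⟩ : ∃ M, Fintype.card V₁ = 2 * M + 2 := ⟨m - 1, by omega⟩
  have hdM : 2 * d ≤ M := by omega
  have hlen : p.length = 2 * M + 1 := by rw [hp.length_eq]; omega
  let q : ℕ → V₁ := p.getVert
  have hq : ∀ i, i + 1 < 2 * M + 2 → G₁.Adj (q i) (q (i + 1)) := by
    intro i hi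
    exact p.adj_getVert_succ (by omega)
  have hinj : ∀ i j, i < 2 * M + 2 → j < 2 * M + 2 → q i = q j → i = j := by
    intro i j hi hj hij
    refine hp.isPath.getVert_injOn ?_ ?_ hij
    · show i ≤ p.length
      omega
    · show j ≤ p.length
      omega
  obtain ⟨κ, hκ⟩ := exists_blocks G₂ G₂.minDegree G₂.minDegree_le_degree hdeg hmin
  have hd1 : ∀ a b c, G₂.Adj a b → G₂.Adj b c → a ≠ c → 1 ≤ d := by
    intro a b c hab hbc hac
    have h1 : ({a, c} : Finset V₂) ⊆ G₂.neighborFinset b := by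
      intro z hz
      simp only [Finset.mem_insert, Finset.mem_singleton] at hz
      rcases hz with rfl | rfl
      · simpa using hab.symm
      · simpa using hbc
    have h2 := Finset.card_le_card h1
    rw [Finset.card_pair hac, card_neighborFinset_eq_degree] at h2
    have := hdm b
    omega
  have hC : ∀ y j₀, ColCyc G₁ G₂ q M d {z | κ z = κ y} y j₀ := fun y j₀ =>
    col hq hinj {z | κ z = κ y} hdM (hκ y) hd1 y rfl j₀
  have hdeg' : ∀ x, G₂.degree x ≤ d + 1 := fun x => hd ▸ hdm x
  obtain ⟨W₀, hW₀n, hW₀⟩ := stage_init hdeg' (hκ v₀) (hC v₀ 0)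
  obtain ⟨W, hW, hmax⟩ := (Finset.univ.filter
    (fun W : Finset V₂ => W.Nonempty ∧ Stage G₁ G₂ q M κ W)).exists_max_image Finset.card
    ⟨W₀, by simp [hW₀n, hW₀]⟩
  simp only [Finset.mem_filter, Finset.mem_univ, true_and] at hW hmax
  obtain ⟨⟨w, hw⟩, hst⟩ := hW
  have huniv : ∀ z, z ∈ W := by
    by_contra hne
    push Not at hne
    obtain ⟨z, hz⟩ := hne
    obtain ⟨r⟩ := hconn.preconnected w z
    obtain ⟨e, -, he1, he2⟩ := r.exists_boundary_dart (W : Set V₂) (by simpa using hw)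
      (by simpa using hz)
    obtain ⟨W', hW', hs'⟩ := stage_step hdeg' hinj hst (by simpa using he1) (by simpa using he2)
      e.adj (hκ e.snd) (hC e.snd)
    have hne' : W'.Nonempty := Finset.card_pos.1 (by omega)
    have := hmax W' ⟨hne', hs'⟩
    omega
  obtain ⟨-, A, -, hcyc, -⟩ := hst
  have hS : rowS q 0 (2 * M + 2) (W : Set V₂) = Set.univ := by
    rw [Set.eq_univ_iff_forall]
    rintro ⟨r, z⟩
    obtain ⟨i, hi, hi'⟩ := Walk.mem_support_iff_exists_getVert.1 (hp.mem_support r)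
    exact ⟨i, by omega, by omega, hi.symm, by simpa using huniv z⟩
  rw [hS] at hcyc
  refine hcyc.isHamiltonian ?_
  rw [Fintype.card_prod]
  nlinarith
end
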